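/- Let Λ be the Leech lattice. Then the automorphism group Aut(Λ) acts transitively on the set of frames of Λ, i.e. there is exactly one Aut(Λ)-orbit of frames, and the index [Aut(Λ) : Stab(frame)] of the stabilizer of a frame, which equals the number of frames, is 8292375 = 3^6·5^3·7·13; in particular this index is odd. -/

import Mathlib

open Matrix Module

/-- An even unimodular positive definite lattice of rank `m`, presented by the Gram
matrix of a `ℤ`-basis.  The underlying `ℤ`-module is `Fin m → ℤ`. -/
structure EvenUnimodularLattice (m : ℕ) where
  gram : Matrix (Fin m) (Fin m) ℤ
  symm : gram.IsSymm
  posdef : ∀ x : Fin m → ℤ, x ≠ 0 → 0 < x ⬝ᵥ gram.mulVec x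
  even : ∀ x : Fin m → ℤ, 2 ∣ x ⬝ᵥ gram.mulVec x
  unimodular : gram.det = 1

namespace EvenUnimodularLattice

variable {m : ℕ} (Λ : EvenUnimodularLattice m)

/-- The bilinear form `(x, y)` of the lattice. -/
def inner (Λ : EvenUnimodularLattice m) (x y : Fin m → ℤ) : ℤ := x ⬝ᵥ Λ.gram.mulVec y

/-- Reduction modulo `2Λ`, identifying `Λ/2Λ` with `(F₂)^m` via the chosen basis. -/
def red (_Λ : EvenUnimodularLattice m) (x : Fin m → ℤ) : Fin m → ZMod 2 := fun i => (x i : ZMod 2)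

/-- A subspace `F ⊆ Λ/2Λ` is isotropic for the quadratic form
`q(x mod 2Λ) = (x,x)/2 mod 2`, i.e. `(x,x) ≡ 0 (mod 4)` for every lift `x` of an
element of `F`. -/
def Isotropic (F : Submodule (ZMod 2) (Fin m → ZMod 2)) : Prop :=
  ∀ x : Fin m → ℤ, Λ.red x ∈ F → (4 : ℤ) ∣ Λ.inner x x

/-- A maximal isotropic subspace of `Λ/2Λ`. -/
def MaximalIsotropic (F : Submodule (ZMod 2) (Fin m → ZMod 2)) : Prop :=
  Λ.Isotropic F ∧ ∀ F', Λ.Isotropic F' → F ≤ F' → F' = F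

end EvenUnimodularLattice

def IsLeech (Λ : EvenUnimodularLattice 24) : Prop :=
  ∀ v : Fin 24 → ℤ, Λ.inner v v ≠ 2

/-- A frame of the Leech lattice: 24 distinct pairs `±v` (48 vectors) of norm-8
vectors, all congruent to each other modulo `2Λ`. -/
def IsFrame (Λ : EvenUnimodularLattice 24) (S : Set (Fin 24 → ℤ)) : Prop :=
  Nat.card S = 48 ∧ (∀ v ∈ S, -v ∈ S) ∧ (∀ v ∈ S, Λ.inner v v = 8) ∧
  (∀ v ∈ S, ∀ u ∈ S, Λ.red v = Λ.red u)

namespace LeechAux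

open MeasureTheory Set Filter Topology

/-- Multi-dimensional Poisson summation, at the origin. -/
theorem poisson_pi {n : ℕ} (f : (Fin n → ℝ) → ℂ) (hf : Continuous f) (hfi : Integrable f)
    (hb : ∀ R : ℝ, ∃ u : (Fin n → ℤ) → ℝ, Summable u ∧
      ∀ k, ∀ x : Fin n → ℝ, ‖x‖ < R → ‖f (x + fun i => (k i : ℝ))‖ ≤ u k)
    (c : (Fin n → ℤ) → ℂ)
    (hc : ∀ m : Fin n → ℤ,
      c m = ∫ x : Fin n → ℝ, UnitAddTorus.mFourier (-m) (fun i => (x i : UnitAddCircle)) * f x)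
    (hs : Summable c) :
    HasSum c (∑' k : Fin n → ℤ, f (fun i => (k i : ℝ))) := by
  set G : (Fin n → ℝ) → ℂ := fun x => ∑' k : Fin n → ℤ, f (x + fun i => (k i : ℝ)) with hG
  have hGc : Continuous G := by
    rw [continuous_iff_continuousAt]
    intro x
    obtain ⟨u, hu, hub⟩ := hb (‖x‖ + 1)
    have : ContinuousOn G (Metric.ball 0 (‖x‖ + 1)) := by
      refine continuousOn_tsum (fun k => ?_) hu (fun k y hy => hub k y (by simpa using hy))
      fun_prop
    exact this.continuousAt (Metric.isOpen_ball.mem_nhds (by simp))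
  have hper : ∀ (x : Fin n → ℝ) (l : Fin n → ℤ), G (x + fun i => (l i : ℝ)) = G x := by
    intro x l
    simp only [hG]
    rw [← (Equiv.addLeft l).tsum_eq (fun k : Fin n → ℤ => f (x + fun i => (k i : ℝ)))]
    congr 1; ext k; congr 1; ext i; simp [add_assoc]
  set π : (Fin n → ℝ) → UnitAddTorus (Fin n) := Pi.map (fun _ x => (x : UnitAddCircle)) with hπ
  have hq : IsOpenQuotientMap π := IsOpenQuotientMap.piMap (fun i =>
    QuotientAddGroup.isOpenQuotientMap_mk)
  set F : UnitAddTorus (Fin n) → ℂ := fun t => G (Function.surjInv hq.surjective t) with hF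
  have hFG : ∀ x, F (π x) = G x := by
    intro x
    have h1 : π (Function.surjInv hq.surjective (π x)) = π x := Function.surjInv_eq _ _
    set y := Function.surjInv hq.surjective (π x) with hy
    have h2 : ∀ i, ∃ l : ℤ, y i = x i + l := by
      intro i
      have := congrFun h1 i
      simp only [hπ, Pi.map_apply] at this
      have h3 : ((y i : ℝ) : UnitAddCircle) = ((x i : ℝ) : UnitAddCircle) := this
      rw [QuotientAddGroup.eq] at h3
      obtain ⟨l, hl⟩ := AddSubgroup.mem_zmultiples_iff.mp h3
      refine ⟨-l, ?_⟩
      simp at hl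
      push_cast
      linarith
    choose l hl using h2
    have : y = x + fun i => (l i : ℝ) := funext hl
    change G y = G x
    rw [this, hper]
  have hFc : Continuous F := by
    rw [hq.isQuotientMap.continuous_iff]
    have : F ∘ π = G := funext hFG
    rw [this]; exact hGc
  -- the Fourier coefficients
  have hbox : MeasurableSet {x : Fin n → ℝ | ∀ i, x i ∈ Ioc (0:ℝ) (0 + 1)} :=
    MeasurableSet.univ_pi' (fun i => measurableSet_Ioc)
  have hcoef : ∀ m, UnitAddTorus.mFourierCoeff F m = c m := by
    intro m
    set e : (Fin n → ℝ) → ℂ := fun x => UnitAddTorus.mFourier (-m) (π x) with he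
    have hec : Continuous e := (map_continuous _).comp hq.continuous
    have hen : ∀ x, ‖e x‖ ≤ 1 := fun x => by
      have := (UnitAddTorus.mFourier (-m)).norm_coe_le_norm (π x)
      rwa [UnitAddTorus.mFourier_norm] at this
    have hep : ∀ (x : Fin n → ℝ) (k : Fin n → ℤ), e (x + fun i => (k i : ℝ)) = e x := by
      intro x k
      simp only [he]
      congr 1
      ext i
      simp [hπ]
    have h_int : Integrable (fun x => e x * f x) :=
      hfi.bdd_mul (c := 1) hec.aestronglyMeasurable (Eventually.of_forall hen)
    rw [UnitAddTorus.mFourierCoeff_eq_integral F m (fun _ => 0), hc]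
    set B : (Fin n → ℤ) → Set (Fin n → ℝ) := fun k => {x | ∀ i, x i ∈ Ioc (k i : ℝ) (k i + 1)} with hB
    have hU : (⋃ k, B k) = univ := by
      rw [eq_univ_iff_forall]
      intro x
      refine mem_iUnion.mpr ⟨fun i => ⌈x i⌉ - 1, fun i => ?_⟩
      have := Int.ceil_lt_add_one (x i)
      have := Int.le_ceil (x i)
      simp only [mem_Ioc]; push_cast; constructor <;> linarith
    have hD : Pairwise (Function.onFun Disjoint B) := by
      intro k l hkl
      rw [Function.onFun, Set.disjoint_left]
      intro x hx hy
      apply hkl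
      ext i
      have h1 := hx i; have h2 := hy i
      simp only [mem_Ioc] at h1 h2
      have h3 : (k i : ℝ) < l i + 1 := by linarith
      have h4 : (l i : ℝ) < k i + 1 := by linarith
      have h3' : k i < l i + 1 := by exact_mod_cast h3
      have h4' : l i < k i + 1 := by exact_mod_cast h4
      omega
    have hM : ∀ k, MeasurableSet (B k) := fun k =>
      MeasurableSet.univ_pi' (fun i => measurableSet_Ioc)
    have hsum := hasSum_integral_iUnion (μ := volume) (f := fun x => e x * f x) hM hD
      h_int.integrableOn
    rw [hU, setIntegral_univ] at hsum
    have htr : ∀ k, ∫ x in B k, e x * f x =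
        ∫ x in {x : Fin n → ℝ | ∀ i, x i ∈ Ioc (0:ℝ) (0 + 1)}, e x * f (x + fun i => (k i : ℝ)) := by
      intro k
      have := (measurePreserving_add_right (volume : Measure (Fin n → ℝ))
        (fun i => (k i : ℝ))).setIntegral_preimage_emb
        (measurableEmbedding_addRight _) (fun x => e x * f x) (B k)
      rw [← this]
      have hset : (fun x : Fin n → ℝ => x + fun i => (k i : ℝ)) ⁻¹' B k =
          {x : Fin n → ℝ | ∀ i, x i ∈ Ioc (0:ℝ) (0 + 1)} := by
        ext x
        simp only [hB, mem_preimage, mem_ofPred_eq, Pi.add_apply, mem_Ioc]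
        refine forall_congr' fun i => ?_
        constructor <;> rintro ⟨h1, h2⟩ <;> constructor <;> linarith
      rw [hset]
      simp only [hep]
    simp_rw [htr] at hsum
    obtain ⟨u, hu, hub⟩ := hb 2
    have hxb : ∀ x ∈ {x : Fin n → ℝ | ∀ i, x i ∈ Ioc (0:ℝ) (0 + 1)}, ‖x‖ < 2 := by
      intro x hx
      refine lt_of_le_of_lt ((pi_norm_le_iff_of_nonneg zero_le_one).mpr fun i => ?_) one_lt_two
      have := hx i
      simp only [mem_Ioc] at this
      rw [Real.norm_eq_abs, abs_le]; constructor <;> linarith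
    set μ := (volume : Measure (Fin n → ℝ)).restrict {x : Fin n → ℝ | ∀ i, x i ∈ Ioc (0:ℝ) (0 + 1)}
    have hμ : IsFiniteMeasure μ := by
      constructor
      rw [Measure.restrict_apply_univ]
      refine lt_of_le_of_lt (measure_mono (t := Metric.ball 0 2) fun x hx => by
        simpa using hxb x hx) measure_ball_lt_top
    have hae : ∀ k, ∀ᵐ x ∂μ, ‖e x * f (x + fun i => (k i : ℝ))‖ ≤ u k := by
      intro k
      filter_upwards [ae_restrict_mem hbox] with x hx
      rw [norm_mul]
      have := hub k x (hxb x hx)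
      nlinarith [hen x, norm_nonneg (e x), norm_nonneg (f (x + fun i => (k i : ℝ)))]
    have hik : ∀ k : Fin n → ℤ, Integrable (fun x => e x * f (x + fun i => (k i : ℝ))) μ := by
      intro k
      refine Integrable.mono' (integrable_const (u k)) ?_ (hae k)
      exact Continuous.aestronglyMeasurable (by fun_prop)
    have hsw := hasSum_integral_of_summable_integral_norm (μ := μ)
      (F := fun (k : Fin n → ℤ) x => e x * f (x + fun i => (k i : ℝ))) hik ?_
    · refine Eq.trans ?_ (hsw.unique hsum)
      refine integral_congr_ae (Eventually.of_forall fun x => ?_)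
      have h1 := hFG x
      simp only [hG, smul_eq_mul] at h1 ⊢
      rw [tsum_mul_left, ← h1]
      rfl
    · refine Summable.of_nonneg_of_le (fun k => integral_nonneg fun x => norm_nonneg _)
        (fun k => ?_) (hu.mul_left (μ.real univ))
      calc _ ≤ ∫ x, u k ∂μ := integral_mono_ae (hik k).norm (integrable_const _) (hae k)
        _ = _ := by simp
  have hs' : Summable (UnitAddTorus.mFourierCoeff (⟨F, hFc⟩ : C(UnitAddTorus (Fin n), ℂ))) := by
    convert! hs using 1
    exact funext hcoef
  have := UnitAddTorus.hasSum_mFourier_series_apply_of_summable hs' (π 0)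
  have h0 : (⟨F, hFc⟩ : C(UnitAddTorus (Fin n), ℂ)) (π 0) = ∑' k : Fin n → ℤ, f (fun i => (k i : ℝ)) := by
    change F (π 0) = _
    rw [hFG]
    simp [hG]
  rw [h0] at this
  convert! this using 1
  ext m
  change c m = UnitAddTorus.mFourierCoeff F m • _
  rw [hcoef]
  simp [UnitAddTorus.mFourier, hπ]

end LeechAux

namespace LeechAux

open MeasureTheory Set Filter Topology

theorem summable_prod_pi {g : ℤ → ℝ} (hg : Summable g) (hg0 : ∀ k, 0 ≤ g k) (n : ℕ) :
    Summable (fun k : Fin n → ℤ => ∏ i, g (k i)) := by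
  induction n with
  | zero => exact Summable.of_finite
  | succ n ih =>
    rw [← (Fin.consEquiv (fun _ : Fin (n + 1) => ℤ)).summable_iff]
    have := hg.mul_of_nonneg ih hg0 (fun k => Finset.prod_nonneg fun i _ => hg0 _)
    refine this.congr fun p => ?_
    simp [Fin.prod_univ_succ, Fin.consEquiv]

theorem summable_exp_sq {c : ℝ} (hc : 0 < c) : Summable (fun k : ℤ => Real.exp (-c * (k:ℝ)^2)) := by
  have h := (summable_jacobiTheta₂_term_iff 0 ((c / Real.pi : ℝ) * Complex.I)).mpr (by
    simp; positivity)
  refine h.norm.congr fun k => ?_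
  rw [norm_jacobiTheta₂_term]
  congr 1
  simp
  field_simp

theorem summable_exp_normsq {n : ℕ} {c : ℝ} (hc : 0 < c) :
    Summable (fun k : Fin n → ℤ => Real.exp (-c * ‖fun i => (k i : ℝ)‖ ^ 2)) := by
  rcases Nat.eq_zero_or_pos n with rfl | hn
  · exact Summable.of_finite
  have hn' : (0:ℝ) < n := by exact_mod_cast hn
  have h1 := summable_prod_pi (summable_exp_sq (div_pos hc hn')) (fun k => (Real.exp_pos _).le) n
  refine Summable.of_nonneg_of_le (fun k => (Real.exp_pos _).le) (fun k => ?_) h1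
  rw [← Real.exp_sum, Real.exp_le_exp]
  rw [← Finset.mul_sum]
  have : ∑ i, ((k i : ℝ))^2 ≤ n * ‖fun i => (k i : ℝ)‖ ^ 2 := by
    calc _ ≤ ∑ i : Fin n, ‖fun i => (k i : ℝ)‖ ^ 2 := by
          refine Finset.sum_le_sum fun i _ => ?_
          have := norm_le_pi_norm (fun i => (k i : ℝ)) i
          rw [← sq_abs]; gcongr; exact this
      _ = _ := by simp
  have h2 : c / n * ∑ i, ((k i : ℝ))^2 ≤ c * ‖fun i => (k i : ℝ)‖ ^ 2 := by
    calc _ ≤ c / n * (n * ‖fun i => (k i : ℝ)‖ ^ 2) := by gcongr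
      _ = _ := by field_simp
  linarith

open scoped MatrixOrder in
/-- The Gram matrix has a real square root. -/
theorem exists_sqrt {m : ℕ} (Λ : EvenUnimodularLattice m) :
    ∃ B : Matrix (Fin m) (Fin m) ℝ, Bᵀ * B = Λ.gram.map (Int.cast : ℤ → ℝ) ∧ |B.det| = 1 := by
  set A := Λ.gram.map (Int.cast : ℤ → ℝ) with hA
  have h_int : ∀ x : Fin m → ℤ, 0 ≤ (fun i => (x i : ℝ)) ⬝ᵥ (A *ᵥ (fun i => (x i : ℝ))) := by
    intro x
    have h1 : (fun i => (x i : ℝ)) ⬝ᵥ (A *ᵥ (fun i => (x i : ℝ))) =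
        ((x ⬝ᵥ Λ.gram.mulVec x : ℤ) : ℝ) := by
      simp [dotProduct, mulVec, hA]
    rw [h1]
    rcases eq_or_ne x 0 with rfl | hx
    · simp
    · exact_mod_cast (Λ.posdef x hx).le
  have hcont : Continuous (fun x : Fin m → ℝ => x ⬝ᵥ (A *ᵥ x)) := by
    unfold dotProduct mulVec dotProduct
    fun_prop
  have hrat : ∀ x : Fin m → ℚ, 0 ≤ (fun i => (x i : ℝ)) ⬝ᵥ (A *ᵥ (fun i => (x i : ℝ))) := by
    intro x
    set N : ℕ := ∏ i, (x i).den with hN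
    have hNpos : 0 < N := Finset.prod_pos fun i _ => (x i).pos
    have h2 : ∀ i, ∃ z : ℤ, (z : ℝ) = N * (x i : ℝ) := by
      intro i
      obtain ⟨d, hd⟩ : (x i).den ∣ N := Finset.dvd_prod_of_mem (fun i => (x i).den) (Finset.mem_univ i)
      refine ⟨d * (x i).num, ?_⟩
      rw [hd]
      have : (x i : ℝ) * (x i).den = (x i).num := by exact_mod_cast Rat.mul_den_eq_num (x i)
      push_cast
      rw [← this]; ring
    choose z hz using h2
    have h3 := h_int z
    have h4 : (fun i => (z i : ℝ)) = (N : ℝ) • (fun i => (x i : ℝ)) := by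
      ext i; simp [hz]
    rw [h4, mulVec_smul, dotProduct_smul, smul_dotProduct, smul_eq_mul, smul_eq_mul] at h3
    have : (0:ℝ) < N := by exact_mod_cast hNpos
    by_contra hneg
    push Not at hneg
    have := mul_neg_of_pos_of_neg this (mul_neg_of_pos_of_neg this hneg)
    linarith
  have hreal : ∀ x : Fin m → ℝ, 0 ≤ x ⬝ᵥ (A *ᵥ x) := by
    have hd : DenseRange (fun (x : Fin m → ℚ) (i : Fin m) => (x i : ℝ)) :=
      DenseRange.piMap (fun i => Rat.denseRange_cast)
    intro x
    have hcl : IsClosed {x : Fin m → ℝ | 0 ≤ x ⬝ᵥ (A *ᵥ x)} := isClosed_le continuous_const hcont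
    exact hd.induction_on (p := fun x => 0 ≤ x ⬝ᵥ (A *ᵥ x)) x hcl hrat
  have hherm : A.IsHermitian := by
    rw [Matrix.IsHermitian, conjTranspose_eq_transpose_of_trivial, hA, ← Matrix.transpose_map, Λ.symm]
  have hps : A.PosSemidef := .of_dotProduct_mulVec_nonneg hherm (by simpa using hreal)
  obtain ⟨B, hB⟩ := CStarAlgebra.nonneg_iff_eq_star_mul_self.mp hps.nonneg
  rw [star_eq_conjTranspose] at hB
  refine ⟨B, ?_, ?_⟩
  · rw [hB, conjTranspose_eq_transpose_of_trivial]
  · have hdet : A.det = 1 := by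
      have := (Int.castRingHom ℝ).map_det Λ.gram
      rw [Λ.unimodular] at this
      simp only [map_one] at this
      rw [this]; rfl
    rw [hB, conjTranspose_eq_transpose_of_trivial, det_mul, det_transpose] at hdet
    have := abs_mul_abs_self B.det
    nlinarith [abs_nonneg B.det]

end LeechAux

namespace LeechAux

open MeasureTheory Set Filter Topology

theorem exists_lower_bound {n : ℕ} (B : Matrix (Fin n) (Fin n) ℝ) (hB : |B.det| = 1) :
    ∃ c : ℝ, 0 < c ∧ ∀ x : Fin n → ℝ, c * ‖x‖ ^ 2 ≤ ∑ i, ((B *ᵥ x) i) ^ 2 := by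
  have hu : IsUnit B.det := by
    rw [isUnit_iff_ne_zero]; intro h; simp [h] at hB
  obtain ⟨C, hC0, hC⟩ := (LinearMap.toContinuousLinearMap (Matrix.toLin' B⁻¹)).bound
  refine ⟨(C ^ 2)⁻¹, by positivity, fun x => ?_⟩
  have h1 : ‖x‖ ≤ C * ‖B *ᵥ x‖ := by
    have := hC (B *ᵥ x)
    simpa [Matrix.nonsing_inv_mul _ hu] using this
  have h2 : ‖B *ᵥ x‖ ^ 2 ≤ ∑ i, ((B *ᵥ x) i) ^ 2 := by
    have : ‖B *ᵥ x‖ ≤ √(∑ i, ((B *ᵥ x) i) ^ 2) := by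
      refine (pi_norm_le_iff_of_nonneg (Real.sqrt_nonneg _)).mpr fun i => ?_
      refine Real.le_sqrt_of_sq_le ?_
      rw [Real.norm_eq_abs, sq_abs]
      exact Finset.single_le_sum (f := fun i => ((B *ᵥ x) i) ^ 2) (fun i _ => sq_nonneg _)
        (Finset.mem_univ i)
    calc _ ≤ (√(∑ i, ((B *ᵥ x) i) ^ 2)) ^ 2 := by gcongr
      _ = _ := Real.sq_sqrt (Finset.sum_nonneg fun i _ => sq_nonneg _)
  calc (C ^ 2)⁻¹ * ‖x‖ ^ 2 ≤ (C ^ 2)⁻¹ * (C * ‖B *ᵥ x‖) ^ 2 := by gcongr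
    _ = ‖B *ᵥ x‖ ^ 2 := by field_simp
    _ ≤ _ := h2

theorem sum_sq_eq {n : ℕ} (Λ : EvenUnimodularLattice n) (B : Matrix (Fin n) (Fin n) ℝ)
    (hB : Bᵀ * B = Λ.gram.map (Int.cast : ℤ → ℝ)) (k l : Fin n → ℤ) :
    ∑ i, (B *ᵥ (fun i => (k i : ℝ))) i * (B *ᵥ (fun i => (l i : ℝ))) i = (Λ.inner k l : ℝ) := by
  change (B *ᵥ (fun i => (k i : ℝ))) ⬝ᵥ (B *ᵥ (fun i => (l i : ℝ))) = _
  rw [Matrix.dotProduct_mulVec, Matrix.vecMul_mulVec, ← Matrix.mulVec_transpose]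
  rw [Matrix.transpose_mul, Matrix.transpose_transpose, hB, dotProduct_comm, dotProduct_mulVec,
    ← Matrix.mulVec_transpose, dotProduct_comm, ← Matrix.transpose_map, Λ.symm]
  simp [EvenUnimodularLattice.inner, dotProduct, mulVec]

theorem dot_eq {n : ℕ} (Λ : EvenUnimodularLattice n) (B : Matrix (Fin n) (Fin n) ℝ)
    (hB : Bᵀ * B = Λ.gram.map (Int.cast : ℤ → ℝ)) (k : Fin n → ℤ) (x : Fin n → ℝ) :
    ∑ i, (B *ᵥ (fun i => (k i : ℝ))) i * (B *ᵥ x) i =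
      ∑ i, ((Λ.gram *ᵥ k) i : ℝ) * x i := by
  change (B *ᵥ (fun i => (k i : ℝ))) ⬝ᵥ (B *ᵥ x) = _
  rw [Matrix.dotProduct_mulVec, ← Matrix.mulVec_transpose, Matrix.mulVec_mulVec, hB]
  simp [dotProduct, mulVec]

theorem summable_theta {n : ℕ} (Λ : EvenUnimodularLattice n) {c : ℝ} (hc : 0 < c) :
    Summable (fun k : Fin n → ℤ => Real.exp (-c * (Λ.inner k k : ℝ))) := by
  obtain ⟨B, hB, hdet⟩ := exists_sqrt Λ
  obtain ⟨a, ha, hab⟩ := exists_lower_bound B hdet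
  refine Summable.of_nonneg_of_le (fun k => (Real.exp_pos _).le) (fun k => ?_)
    (summable_exp_normsq (mul_pos hc ha))
  rw [Real.exp_le_exp, ← sum_sq_eq Λ B hB]
  have := hab (fun i => (k i : ℝ))
  simp_rw [pow_two] at this ⊢
  nlinarith

theorem gaussian_integral {n : ℕ} (B : Matrix (Fin n) (Fin n) ℝ) (hdet : |B.det| = 1)
    (g : (Fin n → ℝ) → ℂ) : ∫ x, g (B *ᵥ x) = ∫ y, g y := by
  have h0 : B.det ≠ 0 := by intro h; simp [h] at hdet
  have hmap := Real.map_matrix_volume_pi_eq_smul_volume_pi h0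
  rw [abs_inv, hdet] at hmap
  simp only [inv_one, ENNReal.ofReal_one, one_smul] at hmap
  have hinj : Function.Injective (Matrix.toLin' B) := by
    change Function.Injective (fun x => B *ᵥ x)
    exact Matrix.mulVec_injective_of_isUnit ((Matrix.isUnit_iff_isUnit_det _).mpr
      (isUnit_iff_ne_zero.mpr h0))
  have hemb : MeasurableEmbedding (Matrix.toLin' B) :=
    ((Matrix.toLin' B).continuous_of_finiteDimensional).measurableEmbedding hinj
  have hmp : MeasurePreserving (Matrix.toLin' B) volume volume := ⟨hemb.measurable, hmap⟩
  exact hmp.integral_comp hemb g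

theorem gaussian_integrable {n : ℕ} (B : Matrix (Fin n) (Fin n) ℝ) (hdet : |B.det| = 1)
    (g : (Fin n → ℝ) → ℂ) (hg : Integrable g) : Integrable (fun x => g (B *ᵥ x)) := by
  have h0 : B.det ≠ 0 := by intro h; simp [h] at hdet
  have hmap := Real.map_matrix_volume_pi_eq_smul_volume_pi h0
  rw [abs_inv, hdet] at hmap
  simp only [inv_one, ENNReal.ofReal_one, one_smul] at hmap
  have hinj : Function.Injective (Matrix.toLin' B) := by
    change Function.Injective (fun x => B *ᵥ x)
    exact Matrix.mulVec_injective_of_isUnit ((Matrix.isUnit_iff_isUnit_det _).mpr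
      (isUnit_iff_ne_zero.mpr h0))
  have hemb : MeasurableEmbedding (Matrix.toLin' B) :=
    ((Matrix.toLin' B).continuous_of_finiteDimensional).measurableEmbedding hinj
  have hmp : MeasurePreserving (Matrix.toLin' B) volume volume := ⟨hemb.measurable, hmap⟩
  exact (hmp.integrable_comp_emb hemb).mpr hg

/-- The theta series of a lattice. -/
noncomputable def theta {n : ℕ} (Λ : EvenUnimodularLattice n) (τ : ℂ) : ℂ :=
  ∑' k : Fin n → ℤ, Complex.exp (Real.pi * Complex.I * τ * (Λ.inner k k : ℂ))

theorem norm_theta_term {n : ℕ} (Λ : EvenUnimodularLattice n) (τ : ℂ) (k : Fin n → ℤ) :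
    ‖Complex.exp (Real.pi * Complex.I * τ * (Λ.inner k k : ℂ))‖ =
      Real.exp (-(Real.pi * τ.im) * (Λ.inner k k : ℝ)) := by
  rw [Complex.norm_exp]
  congr 1
  have : Real.pi * Complex.I * τ * (Λ.inner k k : ℂ) =
    ((Real.pi * (Λ.inner k k : ℝ) : ℝ) : ℂ) * (Complex.I * τ) := by push_cast; ring
  rw [this, Complex.re_ofReal_mul]
  simp; ring

theorem hasSum_theta {n : ℕ} (Λ : EvenUnimodularLattice n) {τ : ℂ} (hτ : 0 < τ.im) :
    HasSum (fun k : Fin n → ℤ => Complex.exp (Real.pi * Complex.I * τ * (Λ.inner k k : ℂ)))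
      (theta Λ τ) := by
  apply Summable.hasSum
  apply Summable.of_norm
  simp_rw [norm_theta_term]
  exact summable_theta Λ (by positivity)

theorem theta_transform (Λ : EvenUnimodularLattice 24) {τ : ℂ} (hτ : 0 < τ.im) :
    theta Λ (-1 / τ) = τ ^ 12 * theta Λ τ := by
  obtain ⟨B, hB, hdet⟩ := exists_sqrt Λ
  obtain ⟨a, ha, hab⟩ := exists_lower_bound B hdet
  have hτ0 : τ ≠ 0 := by rintro rfl; simp at hτ
  have hτ' : 0 < (-1 / τ).im := by
    rw [neg_div, one_div, Complex.neg_im, Complex.inv_im]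
    have := Complex.normSq_pos.mpr hτ0
    rw [neg_div, neg_neg]; positivity
  set b : ℂ := -(Real.pi * Complex.I * τ) with hb
  have hbre : 0 < b.re := by
    simp [hb]; positivity
  set f : (Fin 24 → ℝ) → ℂ := fun x =>
    Complex.exp (-∑ i, b * (((B *ᵥ x) i : ℝ) : ℂ) ^ 2 + ∑ i, (0:ℂ) * (((B *ᵥ x) i : ℝ) : ℂ)) with hf
  have hfc : Continuous f := by
    have : Continuous fun x => B *ᵥ x := by fun_prop
    simp only [hf]
    fun_prop
  have hfi : Integrable f := gaussian_integrable B hdet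
    (fun v => Complex.exp (-∑ i, b * ((v i : ℝ) : ℂ) ^ 2 + ∑ i, (0:ℂ) * ((v i : ℝ) : ℂ)))
    (GaussianFourier.integrable_cexp_neg_sum_mul_add (fun _ => hbre) _)
  have hfn : ∀ x, ‖f x‖ = Real.exp (-b.re * ∑ i, ((B *ᵥ x) i)^2) := by
    intro x
    simp only [hf, Complex.norm_exp]
    congr 1
    rw [← Finset.mul_sum]
    have : ∑ i, (((B *ᵥ x) i : ℝ) : ℂ) ^ 2 = ((∑ i, ((B *ᵥ x) i)^2 : ℝ) : ℂ) := by push_cast; rfl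
    rw [this]
    generalize (∑ i, ((B *ᵥ x) i)^2 : ℝ) = s
    simp
  have hfk : ∀ k : Fin 24 → ℤ, f (fun i => (k i : ℝ)) =
      Complex.exp (Real.pi * Complex.I * τ * (Λ.inner k k : ℂ)) := by
    intro k
    simp only [hf]
    congr 1
    rw [← Finset.mul_sum]
    have := sum_sq_eq Λ B hB k k
    have h2 : ∑ i, (((B *ᵥ (fun i => (k i : ℝ))) i : ℝ) : ℂ) ^ 2 = (Λ.inner k k : ℂ) := by
      simp_rw [pow_two]
      exact_mod_cast this
    rw [h2]; simp [hb]
  have hbd : ∀ R : ℝ, ∃ u : (Fin 24 → ℤ) → ℝ, Summable u ∧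
      ∀ k, ∀ x : Fin 24 → ℝ, ‖x‖ < R → ‖f (x + fun i => (k i : ℝ))‖ ≤ u k := by
    intro R
    refine ⟨fun k => Real.exp (b.re * a * R ^ 2) *
      Real.exp (-(b.re * a / 2) * ‖fun i => (k i : ℝ)‖ ^ 2),
      (summable_exp_normsq (by positivity)).mul_left _, fun k x hx => ?_⟩
    beta_reduce
    rw [hfn, ← Real.exp_add, Real.exp_le_exp]
    set y : Fin 24 → ℝ := fun i => (k i : ℝ)
    have h1 := hab (x + y)
    have h2 : ‖y‖ ≤ ‖x + y‖ + ‖x‖ := by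
      calc ‖y‖ = ‖(x + y) - x‖ := by congr 1; abel
        _ ≤ _ := norm_sub_le _ _
    have h3 : ‖y‖ ^ 2 ≤ 2 * ‖x + y‖ ^ 2 + 2 * R ^ 2 := by
      have := norm_nonneg y
      have := norm_nonneg x
      have := norm_nonneg (x + y)
      nlinarith [sq_nonneg (‖x + y‖ - ‖x‖)]
    have h4 : b.re * (a * ‖x + y‖ ^ 2) ≤ b.re * ∑ i, ((B *ᵥ (x + y)) i)^2 := by gcongr
    have h5 : b.re * a * ‖y‖ ^ 2 ≤ b.re * a * (2 * ‖x + y‖ ^ 2 + 2 * R ^ 2) := by gcongr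
    nlinarith
  -- the Fourier transform
  have hfour : ∀ k : Fin 24 → ℤ, ∫ x : Fin 24 → ℝ,
      UnitAddTorus.mFourier (-(Λ.gram *ᵥ k)) (fun i => (x i : UnitAddCircle)) * f x =
      (τ ^ 12)⁻¹ * Complex.exp (Real.pi * Complex.I * (-1 / τ) * (Λ.inner k k : ℂ)) := by
    intro k
    set w : Fin 24 → ℝ := B *ᵥ (fun i => (k i : ℝ)) with hw
    have h1 : ∀ x : Fin 24 → ℝ,
        UnitAddTorus.mFourier (-(Λ.gram *ᵥ k)) (fun i => (x i : UnitAddCircle)) * f x =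
        (fun v : Fin 24 → ℝ => Complex.exp (-∑ i, b * ((v i : ℝ) : ℂ) ^ 2 +
          ∑ i, (-2 * Real.pi * Complex.I * w i) * ((v i : ℝ) : ℂ))) (B *ᵥ x) := by
      intro x
      simp only [hf, UnitAddTorus.mFourier, ContinuousMap.coe_mk, fourier_coe_apply]
      rw [← Complex.exp_sum, ← Complex.exp_add]
      congr 1
      simp only [zero_mul, Finset.sum_const_zero, add_zero]
      rw [add_comm]
      congr 1
      have h2 := dot_eq Λ B hB k x
      have h3 : ∑ i, ((w i : ℝ) : ℂ) * (((B *ᵥ x) i : ℝ) : ℂ) =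
        ∑ i, (((Λ.gram *ᵥ k) i : ℤ) : ℂ) * ((x i : ℝ) : ℂ) := by
        exact_mod_cast congrArg (fun r : ℝ => (r : ℂ)) h2
      have h4 : ∑ i, (-2 * Real.pi * Complex.I * w i) * (((B *ᵥ x) i : ℝ) : ℂ) =
        (-2 * Real.pi * Complex.I) * ∑ i, ((w i : ℝ) : ℂ) * (((B *ᵥ x) i : ℝ) : ℂ) := by
        rw [Finset.mul_sum]; exact Finset.sum_congr rfl fun i _ => by ring
      rw [h4, h3, Finset.mul_sum]
      refine Finset.sum_congr rfl fun i _ => ?_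
      simp
      ring
    refine ((integral_congr_ae (Eventually.of_forall h1)).trans
      (gaussian_integral B hdet (fun v : Fin 24 → ℝ => Complex.exp (-∑ i, b * ((v i : ℝ) : ℂ) ^ 2 +
          ∑ i, (-2 * Real.pi * Complex.I * w i) * ((v i : ℝ) : ℂ))))).trans ?_
    rw [GaussianFourier.integral_cexp_neg_sum_mul_add (fun _ => hbre),
      Finset.prod_mul_distrib, ← Complex.exp_sum]
    congr 1
    · rw [Finset.prod_const, Finset.card_univ, Fintype.card_fin, ← Complex.cpow_nat_mul]
      have : ((24 : ℕ) : ℂ) * (1 / 2) = ((12 : ℕ) : ℂ) := by norm_num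
      rw [this, Complex.cpow_natCast]
      have hpi : (Real.pi : ℂ) ≠ 0 := by exact_mod_cast Real.pi_ne_zero
      have : (Real.pi : ℂ) / b = Complex.I / τ := by
        rw [hb]; field_simp; simp
      rw [this, div_pow]
      have : Complex.I ^ 12 = 1 := by
        rw [show 12 = 4 * 3 from rfl, pow_mul, Complex.I_pow_four, one_pow]
      rw [this, one_div]
    · congr 1
      have := sum_sq_eq Λ B hB k k
      have h2 : ∑ i, ((w i : ℝ) : ℂ) ^ 2 = (Λ.inner k k : ℂ) := by
        simp_rw [pow_two]
        exact_mod_cast this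
      rw [← h2, Finset.mul_sum]
      refine Finset.sum_congr rfl fun i _ => ?_
      have hpi : (Real.pi : ℂ) ≠ 0 := by exact_mod_cast Real.pi_ne_zero
      rw [hb]
      field_simp
      ring_nf
      try ring
  -- reindexing
  have hu : IsUnit Λ.gram.det := by rw [Λ.unimodular]; exact isUnit_one
  let e : (Fin 24 → ℤ) ≃ (Fin 24 → ℤ) :=
    { toFun := fun k => Λ.gram *ᵥ k
      invFun := fun k => Λ.gram⁻¹ *ᵥ k
      left_inv := fun k => by simp [Matrix.nonsing_inv_mul _ hu]
      right_inv := fun k => by simp [Matrix.mul_nonsing_inv _ hu] }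
  set c : (Fin 24 → ℤ) → ℂ := fun m => ∫ x : Fin 24 → ℝ,
      UnitAddTorus.mFourier (-m) (fun i => (x i : UnitAddCircle)) * f x with hc
  have hce : ∀ k, c (e k) = (τ ^ 12)⁻¹ *
      Complex.exp (Real.pi * Complex.I * (-1 / τ) * (Λ.inner k k : ℂ)) := hfour
  have hsum1 := (hasSum_theta Λ hτ').mul_left (τ ^ 12)⁻¹
  have hsum2 : HasSum c ((τ ^ 12)⁻¹ * theta Λ (-1 / τ)) := by
    rw [← e.hasSum_iff]
    exact hsum1.congr_fun (fun k => hce k)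
  have hsum3 := poisson_pi f hfc hfi hbd c (fun m => rfl) hsum2.summable
  have := hsum2.unique hsum3
  simp_rw [hfk] at this
  change _ = theta Λ τ at this
  rw [← this]
  field_simp

end LeechAux

namespace LeechAux

open MeasureTheory Set Filter Topology

theorem inner_nonneg {n : ℕ} (Λ : EvenUnimodularLattice n) (x : Fin n → ℤ) : 0 ≤ Λ.inner x x := by
  rcases eq_or_ne x 0 with rfl | hx
  · simp [EvenUnimodularLattice.inner]
  · exact (Λ.posdef x hx).le

theorem finite_le {n : ℕ} (Λ : EvenUnimodularLattice n) (N : ℤ) :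
    {x : Fin n → ℤ | Λ.inner x x ≤ N}.Finite := by
  have h := (summable_theta Λ one_pos).tendsto_cofinite_zero
  have h2 := h.eventually (gt_mem_nhds (Real.exp_pos (-(N:ℝ))))
  rw [Filter.eventually_cofinite] at h2
  refine h2.subset fun x hx => ?_
  have hx' : (Λ.inner x x : ℝ) ≤ N := by exact_mod_cast hx
  simp only [mem_ofPred_eq, not_lt, Real.exp_le_exp]
  linarith

/-- The number of vectors of norm `2 n`. -/
noncomputable def cnt {m : ℕ} (Λ : EvenUnimodularLattice m) (n : ℕ) : ℕ :=
  Nat.card {x : Fin m → ℤ // Λ.inner x x = 2 * (n : ℤ)}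

theorem theta_hasSum_q {m : ℕ} (Λ : EvenUnimodularLattice m) {τ : ℂ} (hτ : 0 < τ.im) :
    HasSum (fun n : ℕ => (cnt Λ n : ℂ) • (Function.Periodic.qParam 1 τ) ^ n) (theta Λ τ) := by
  let φ : (Fin m → ℤ) → ℕ := fun k => (Λ.inner k k / 2).toNat
  have hφ : ∀ k n, φ k = n ↔ Λ.inner k k = 2 * (n : ℤ) := by
    intro k n
    have h1 := inner_nonneg Λ k
    have h2 : 2 ∣ Λ.inner k k := Λ.even k
    simp only [φ]
    omega
  have h := (Equiv.sigmaFiberEquiv φ).hasSum_iff.mpr (hasSum_theta Λ hτ)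
  refine HasSum.sigma h fun n => ?_
  have hfin : Finite {x // φ x = n} := by
    refine Set.Finite.subset (finite_le Λ (2 * n)) fun x hx => ?_
    exact ((hφ x n).mp hx).le
  have := Fintype.ofFinite {x // φ x = n}
  have h3 : ∀ c : {x // φ x = n}, ((fun k : Fin m → ℤ =>
      Complex.exp (Real.pi * Complex.I * τ * (Λ.inner k k : ℂ))) ∘
        (Equiv.sigmaFiberEquiv φ)) ⟨n, c⟩ = (Function.Periodic.qParam 1 τ) ^ n := by
    rintro ⟨x, hx⟩
    have h4 := (hφ x n).mp hx
    simp only [Function.comp, Equiv.sigmaFiberEquiv, Equiv.coe_fn_mk]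
    rw [h4, Function.Periodic.qParam, ← Complex.exp_nat_mul]
    congr 1
    push_cast
    ring
  have h5 := hasSum_fintype (fun c : {x // φ x = n} => ((fun k : Fin m → ℤ =>
      Complex.exp (Real.pi * Complex.I * τ * (Λ.inner k k : ℂ))) ∘
        (Equiv.sigmaFiberEquiv φ)) ⟨n, c⟩)
  convert h5 using 1
  rw [Finset.sum_congr rfl (fun c _ => h3 c), Finset.sum_const, Finset.card_univ]
  have h6 : cnt Λ n = Fintype.card {x // φ x = n} := by
    rw [cnt, ← Nat.card_eq_fintype_card]
    exact Nat.card_congr (Equiv.subtypeEquivRight fun x => (hφ x n).symm)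
  rw [h6]
  simp

open UpperHalfPlane ModularForm ModularFormClass MatrixGroups EisensteinSeries

theorem theta_diff {m : ℕ} (Λ : EvenUnimodularLattice m) :
    DifferentiableOn ℂ (theta Λ) {z | 0 < z.im} := by
  intro z hz
  have hz : 0 < z.im := hz
  have hopen : IsOpen {w : ℂ | z.im / 2 < w.im} := isOpen_lt continuous_const Complex.continuous_im
  have := Complex.differentiableOn_tsum_of_summable_norm
    (F := fun (k : Fin m → ℤ) (w : ℂ) => Complex.exp (Real.pi * Complex.I * w * (Λ.inner k k : ℂ)))
    (summable_theta Λ (c := Real.pi * (z.im / 2)) (by positivity)) (fun k => by fun_prop)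
    hopen (fun k w hw => by
      rw [norm_theta_term, Real.exp_le_exp]
      have h1 : (0:ℝ) ≤ Λ.inner k k := by exact_mod_cast inner_nonneg Λ k
      have hw : z.im / 2 < w.im := hw
      have h2 : Real.pi * (z.im / 2) ≤ Real.pi * w.im := by gcongr
      nlinarith)
  exact (this.differentiableAt (hopen.mem_nhds (by simp; linarith))).differentiableWithinAt

theorem theta_S (Λ : EvenUnimodularLattice 24) :
    ((fun τ : ℍ => theta Λ τ) ∣[(12 : ℤ)] ModularGroup.S) = (fun τ : ℍ => theta Λ τ) := by
  ext z
  have key : theta Λ (-(z : ℂ)⁻¹) * ((z : ℂ) ^ 12)⁻¹ = theta Λ z := by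
    have h := theta_transform Λ z.2
    have hz := ne_zero z
    rw [neg_div, one_div] at h
    rw [h]
    field_simp
  rw [SL_slash_apply, UpperHalfPlane.modular_S_smul]
  have h1 : UpperHalfPlane.denom (ModularGroup.S : GL (Fin 2) ℝ) z = z := ModularGroup.denom_S z
  rw [h1]
  simpa using! key

theorem theta_T (Λ : EvenUnimodularLattice 24) :
    ((fun τ : ℍ => theta Λ τ) ∣[(12 : ℤ)] ModularGroup.T) = (fun τ : ℍ => theta Λ τ) := by
  ext z
  have key : theta Λ (1 + (z : ℂ)) = theta Λ z := by
    unfold theta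
    congr 1
    ext k
    obtain ⟨c, hc⟩ : (2:ℤ) ∣ Λ.inner k k := Λ.even k
    rw [hc]
    push_cast
    rw [Complex.exp_eq_exp_iff_exists_int]
    exact ⟨c, by ring⟩
  rw [SL_slash_apply, modular_T_smul]
  have h1 : UpperHalfPlane.denom (ModularGroup.T : GL (Fin 2) ℝ) z = 1 := by
    rw [UpperHalfPlane.denom]
    have h2 : (ModularGroup.T : GL (Fin 2) ℝ) 1 0 = ((ModularGroup.T 1 0 : ℤ) : ℝ) := rfl
    have h3 : (ModularGroup.T : GL (Fin 2) ℝ) 1 1 = ((ModularGroup.T 1 1 : ℤ) : ℝ) := rfl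
    rw [h2, h3]
    simp [ModularGroup.T]
  rw [h1]
  simpa using! key

/-- The theta series as a modular form of weight 12 and level one. -/
noncomputable def thetaForm (Λ : EvenUnimodularLattice 24) : ModularForm 𝒮ℒ 12 where
  toFun := fun τ : ℍ => theta Λ τ
  slash_action_eq' A hA := by
    obtain ⟨A, rfl⟩ := hA
    exact SlashInvariantForm.slash_action_generators_SL2Z (theta_S Λ) (theta_T Λ) A
  holo' := by
    rw [UpperHalfPlane.mdifferentiable_iff]
    refine (theta_diff Λ).congr fun z hz ↦ ?_
    simp [ofComplex_apply_of_im_pos hz]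
  bdd_at_cusps' hc := by
    rw [Subgroup.IsArithmetic.isCusp_iff_isCusp_SL2Z] at hc
    rw [OnePoint.isBoundedAt_iff_forall_SL2Z hc]
    intro γ _
    rw [SlashInvariantForm.slash_action_generators_SL2Z (theta_S Λ) (theta_T Λ)]
    exact UpperHalfPlane.isBoundedAtImInfty_of_hasSum_qExpansion one_pos
      (fun τ => theta_hasSum_q Λ τ.2)

theorem thetaForm_coeff (Λ : EvenUnimodularLattice 24) (n : ℕ) :
    (qExpansion 1 (thetaForm Λ)).coeff n = cnt Λ n :=
  (ModularFormClass.qExpansion_coeff_unique (f := thetaForm Λ) (c := fun n => (cnt Λ n : ℂ)) one_pos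
    one_mem_strictPeriods_SL (fun τ => theta_hasSum_q Λ τ.2) n).symm

/-- The comparison form. -/
noncomputable def cmpForm : ModularForm 𝒮ℒ 12 :=
  (7 / 12 : ℂ) • ModularForm.mcast (by decide) (E₄.pow 3) +
    (5 / 12 : ℂ) • ModularForm.mcast (by decide) (E₆.pow 2)

theorem cmpForm_q : qExpansion 1 cmpForm =
    (7 / 12 : ℂ) • (qExpansion 1 E₄ * qExpansion 1 E₄ * qExpansion 1 E₄) +
      (5 / 12 : ℂ) • (qExpansion 1 E₆ * qExpansion 1 E₆) := by
  rw [cmpForm, FunLike.coe_add, ModularForm.qExpansion_add one_pos one_mem_strictPeriods_SL,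
    FunLike.coe_smul, FunLike.coe_smul, ModularForm.qExpansion_smul one_pos one_mem_strictPeriods_SL,
    ModularForm.qExpansion_smul one_pos one_mem_strictPeriods_SL, coe_mcast, coe_mcast,
    ModularForm.qExpansion_pow one_pos one_mem_strictPeriods_SL,
    ModularForm.qExpansion_pow one_pos one_mem_strictPeriods_SL]
  simp only [pow_succ, pow_zero, one_mul]

theorem E4c (m : ℕ) : (qExpansion 1 E₄).coeff m =
    if m = 0 then 1 else 240 * ((∑ d ∈ m.divisors, d ^ 3 : ℕ) : ℂ) := by
  rw [E_qExpansion_coeff _ ⟨2, rfl⟩]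
  norm_num [show bernoulli 4 = -1 / 30 by decide +kernel, ArithmeticFunction.sigma_apply]

theorem E6c (m : ℕ) : (qExpansion 1 E₆).coeff m =
    if m = 0 then 1 else -504 * ((∑ d ∈ m.divisors, d ^ 5 : ℕ) : ℂ) := by
  rw [E_qExpansion_coeff _ ⟨3, rfl⟩]
  norm_num [show bernoulli 6 = 1 / 42 by decide +kernel, ArithmeticFunction.sigma_apply]

theorem cmp_coeffs : (qExpansion 1 cmpForm).coeff 0 = 1 ∧ (qExpansion 1 cmpForm).coeff 1 = 0 ∧
    (qExpansion 1 cmpForm).coeff 2 = 196560 ∧ (qExpansion 1 cmpForm).coeff 3 = 16773120 ∧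
    (qExpansion 1 cmpForm).coeff 4 = 398034000 := by
  rw [cmpForm_q]
  have d1 : Nat.divisors 1 = {1} := by decide
  have d2 : Nat.divisors 2 = {1, 2} := by decide
  have d3 : Nat.divisors 3 = {1, 3} := by decide
  have d4 : Nat.divisors 4 = {1, 2, 4} := by decide
  have a0 := E4c 0
  have a1 := E4c 1
  have a2 := E4c 2
  have a3 := E4c 3
  have a4 := E4c 4
  have b0 := E6c 0
  have b1 := E6c 1
  have b2 := E6c 2
  have b3 := E6c 3
  have b4 := E6c 4
  norm_num [d1, d2, d3, d4, -PowerSeries.coeff_zero_eq_constantCoeff] at a0 a1 a2 a3 a4 b0 b1 b2 b3 b4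
  refine ⟨?_, ?_, ?_, ?_, ?_⟩ <;>
  norm_num [PowerSeries.coeff_mul, Finset.Nat.antidiagonal_succ, a0, a1, a2, a3, a4,
    b0, b1, b2, b3, b4, -PowerSeries.coeff_zero_eq_constantCoeff]

theorem cnt_zero (Λ : EvenUnimodularLattice 24) : cnt Λ 0 = 1 := by
  rw [cnt, Nat.card_eq_one_iff_unique]
  refine ⟨⟨fun a b => ?_⟩, ⟨⟨0, by simp [EvenUnimodularLattice.inner]⟩⟩⟩
  have key : ∀ c : Fin 24 → ℤ, Λ.inner c c = 2 * ((0:ℕ):ℤ) → c = 0 := by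
    intro c hc
    by_contra h
    have := Λ.posdef c h
    change 0 < Λ.inner c c at this
    rw [hc] at this
    simp at this
  ext1
  rw [key _ a.2, key _ b.2]

theorem cnt_one (Λ : EvenUnimodularLattice 24) (hΛ : IsLeech Λ) : cnt Λ 1 = 0 := by
  have : IsEmpty {x : Fin 24 → ℤ // Λ.inner x x = 2 * ((1:ℕ) : ℤ)} :=
    ⟨fun x => hΛ x.1 (by simpa using x.2)⟩
  rw [cnt, Nat.card_of_isEmpty]

theorem thetaForm_eq (Λ : EvenUnimodularLattice 24) (hΛ : IsLeech Λ) : thetaForm Λ = cmpForm := by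
  rw [← sub_eq_zero]
  apply ModularForm.sturm_bound_levelOne
  have h : ∀ n, (qExpansion 1 (thetaForm Λ - cmpForm : ModularForm 𝒮ℒ 12)).coeff n =
      cnt Λ n - (qExpansion 1 cmpForm).coeff n := by
    intro n
    rw [FunLike.coe_sub, ModularForm.qExpansion_sub one_pos one_mem_strictPeriods_SL, map_sub,
      thetaForm_coeff]
  have h2 : ((2:ℕ) : ℕ∞) ≤ (qExpansion 1 (thetaForm Λ - cmpForm : ModularForm 𝒮ℒ 12)).order := by
    refine PowerSeries.nat_le_order _ _ fun i hi => ?_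
    rw [h]
    interval_cases i
    · rw [cmp_coeffs.1, cnt_zero]; simp
    · rw [cmp_coeffs.2.1, cnt_one Λ hΛ]; simp
  refine lt_of_lt_of_le ?_ h2
  have : Int.toNat 12 / 12 = 1 := rfl
  rw [this]
  norm_num

theorem cnt_values (Λ : EvenUnimodularLattice 24) (hΛ : IsLeech Λ) :
    cnt Λ 2 = 196560 ∧ cnt Λ 3 = 16773120 ∧ cnt Λ 4 = 398034000 := by
  have h := thetaForm_coeff Λ
  rw [thetaForm_eq Λ hΛ] at h
  obtain ⟨-, -, h2, h3, h4⟩ := cmp_coeffs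
  rw [h] at h2 h3 h4
  exact_mod_cast And.intro h2 (And.intro h3 h4)

end LeechAux

namespace LeechAux

open Set

section bilin

variable {n : ℕ} (Λ : EvenUnimodularLattice n)

theorem inner_comm (x y : Fin n → ℤ) : Λ.inner x y = Λ.inner y x := by
  unfold EvenUnimodularLattice.inner
  rw [dotProduct_mulVec, ← mulVec_transpose, Λ.symm, dotProduct_comm]

theorem inner_add_left (x y z : Fin n → ℤ) : Λ.inner (x + y) z = Λ.inner x z + Λ.inner y z := by
  simp [EvenUnimodularLattice.inner, add_dotProduct]

theorem inner_add_right (x y z : Fin n → ℤ) : Λ.inner x (y + z) = Λ.inner x y + Λ.inner x z := by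
  simp [EvenUnimodularLattice.inner, mulVec_add]

theorem inner_sub_left (x y z : Fin n → ℤ) : Λ.inner (x - y) z = Λ.inner x z - Λ.inner y z := by
  simp [EvenUnimodularLattice.inner, sub_dotProduct]

theorem inner_sub_right (x y z : Fin n → ℤ) : Λ.inner x (y - z) = Λ.inner x y - Λ.inner x z := by
  simp [EvenUnimodularLattice.inner, mulVec_sub]

theorem inner_neg_left (x y : Fin n → ℤ) : Λ.inner (-x) y = -Λ.inner x y := by
  simp [EvenUnimodularLattice.inner]

theorem inner_neg_right (x y : Fin n → ℤ) : Λ.inner x (-y) = -Λ.inner x y := by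
  simp [EvenUnimodularLattice.inner, mulVec_neg]

theorem inner_smul_left (c : ℤ) (x y : Fin n → ℤ) : Λ.inner (c • x) y = c * Λ.inner x y := by
  rw [EvenUnimodularLattice.inner, smul_dotProduct, smul_eq_mul, EvenUnimodularLattice.inner]

theorem inner_smul_right (c : ℤ) (x y : Fin n → ℤ) : Λ.inner x (c • y) = c * Λ.inner x y := by
  rw [EvenUnimodularLattice.inner, mulVec_smul, dotProduct_smul, smul_eq_mul,
    EvenUnimodularLattice.inner]

theorem inner_zero_left (x : Fin n → ℤ) : Λ.inner 0 x = 0 := by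
  simp [EvenUnimodularLattice.inner]

theorem inner_zero_right (x : Fin n → ℤ) : Λ.inner x 0 = 0 := by
  simp [EvenUnimodularLattice.inner]

theorem inner_sum_left {ι : Type*} (s : Finset ι) (f : ι → Fin n → ℤ) (y : Fin n → ℤ) :
    Λ.inner (∑ i ∈ s, f i) y = ∑ i ∈ s, Λ.inner (f i) y := by
  simp [EvenUnimodularLattice.inner, sum_dotProduct]

theorem red_eq_iff (x y : Fin n → ℤ) : Λ.red x = Λ.red y ↔ ∃ w, x = y + (2:ℤ) • w := by
  constructor
  · intro h
    have : ∀ i, ∃ c, x i = y i + 2 * c := by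
      intro i
      have hi := congrFun h i
      simp only [EvenUnimodularLattice.red] at hi
      have h2 := (ZMod.intCast_eq_intCast_iff_dvd_sub _ _ _).mp hi.symm
      obtain ⟨c, hc⟩ := h2
      exact ⟨c, by push_cast at hc; linarith⟩
    choose c hc using this
    exact ⟨c, funext fun i => by simp [hc]⟩
  · rintro ⟨w, rfl⟩
    funext i
    have : (2 : ZMod 2) = 0 := rfl
    simp [EvenUnimodularLattice.red, this]

theorem red_neg (x : Fin n → ℤ) : Λ.red (-x) = Λ.red x := by
  rw [red_eq_iff]
  exact ⟨-x, by ext i; simp; ring⟩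

end bilin

variable (Λ : EvenUnimodularLattice 24)

theorem norm_ge_four (hΛ : IsLeech Λ) {x : Fin 24 → ℤ} (hx : x ≠ 0) : 4 ≤ Λ.inner x x := by
  have h1 : 0 < Λ.inner x x := Λ.posdef x hx
  have h2 : 2 ∣ Λ.inner x x := Λ.even x
  have h3 := hΛ x
  omega

theorem congr_short (hΛ : IsLeech Λ) {u v : Fin 24 → ℤ} (hu : Λ.inner u u ≤ 8)
    (hv : Λ.inner v v ≤ 8) (h : Λ.red u = Λ.red v) (h1 : u ≠ v) (h2 : u ≠ -v) :
    Λ.inner u u = 8 ∧ Λ.inner v v = 8 ∧ Λ.inner u v = 0 := by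
  obtain ⟨w, hw⟩ := (red_eq_iff Λ u v).mp h
  have hw0 : w ≠ 0 := by rintro rfl; simp at hw; exact h1 hw
  have hw1 : v + w ≠ 0 := by
    intro h0
    apply h2
    rw [hw]
    have : w = -v := by rw [eq_neg_iff_add_eq_zero, add_comm]; exact h0
    rw [this]; ext i; simp; ring
  have a := norm_ge_four Λ hΛ hw0
  have b := norm_ge_four Λ hΛ hw1
  subst hw
  simp only [inner_add_left, inner_add_right, inner_smul_left, inner_smul_right,
    inner_comm Λ w v] at *
  omega

/-- The norm-8 vectors in a class mod 2. -/
def fiber (c : Fin 24 → ZMod 2) : Set (Fin 24 → ℤ) := {x | Λ.inner x x = 8 ∧ Λ.red x = c}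

theorem fiber_finite (c : Fin 24 → ZMod 2) : (fiber Λ c).Finite :=
  (finite_le Λ 8).subset fun _ hx => hx.1.le

/-- a half of the fiber -/
def half (S : Set (Fin 24 → ℤ)) : Set (Fin 24 → ℤ) := {x | x ∈ S ∧ toLex 0 < toLex x}

theorem half_union (S : Set (Fin 24 → ℤ)) (hneg : ∀ v ∈ S, -v ∈ S) (h0 : 0 ∉ S) :
    S = half S ∪ Neg.neg '' half S := by
  ext x
  constructor
  · intro hx
    have hx0 : x ≠ 0 := fun h => h0 (h ▸ hx)
    rcases lt_trichotomy (toLex (0 : Fin 24 → ℤ)) (toLex x) with h | h | h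
    · exact Or.inl ⟨hx, h⟩
    · exact absurd (toLex.injective h).symm hx0
    · refine Or.inr ⟨-x, ⟨hneg x hx, ?_⟩, neg_neg x⟩
      have := neg_lt_neg h
      simpa using! this
  · rintro (h | ⟨y, hy, rfl⟩)
    · exact h.1
    · exact hneg _ hy.1

theorem half_disj (S : Set (Fin 24 → ℤ)) : Disjoint (half S) (Neg.neg '' half S) := by
  rw [Set.disjoint_left]
  rintro x hx ⟨y, hy, rfl⟩
  have h1 := hx.2
  have h2 := neg_lt_neg hy.2
  have h3 : toLex (-y) < toLex (0 : Fin 24 → ℤ) := by simpa using! h2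
  exact lt_asymm h1 h3

theorem half_ncard (S : Set (Fin 24 → ℤ)) (hf : S.Finite) (hneg : ∀ v ∈ S, -v ∈ S) (h0 : 0 ∉ S) :
    S.ncard = 2 * (half S).ncard := by
  have hfh : (half S).Finite := hf.subset fun x hx => hx.1
  conv_lhs => rw [half_union S hneg h0]
  rw [Set.ncard_union_eq (half_disj S) hfh (hfh.image _), Set.ncard_image_of_injective _ neg_injective]
  ring

theorem fiber_neg (c : Fin 24 → ZMod 2) : ∀ v ∈ fiber Λ c, -v ∈ fiber Λ c := by
  rintro v ⟨h1, h2⟩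
  exact ⟨by simp [inner_neg_left, inner_neg_right, h1], by rw [red_neg, h2]⟩

theorem fiber_zero (c : Fin 24 → ZMod 2) : 0 ∉ fiber Λ c := by
  rintro ⟨h, -⟩
  simp [inner_zero_left] at h

theorem half_orth (hΛ : IsLeech Λ) (c : Fin 24 → ZMod 2) {u v : Fin 24 → ℤ}
    (hu : u ∈ half (fiber Λ c)) (hv : v ∈ half (fiber Λ c)) (huv : u ≠ v) : Λ.inner u v = 0 := by
  refine (congr_short Λ hΛ hu.1.1.le hv.1.1.le (hu.1.2.trans hv.1.2.symm) huv ?_).2.2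
  intro h
  exact Set.disjoint_left.mp (half_disj (fiber Λ c)) hu ⟨v, hv, h.symm⟩

theorem orth_linind {ι : Type*} (v : ι → Fin 24 → ℤ) (h8 : ∀ i, Λ.inner (v i) (v i) = 8)
    (ho : ∀ i j, i ≠ j → Λ.inner (v i) (v j) = 0) : LinearIndependent ℤ v := by
  rw [linearIndependent_iff']
  intro s g hg i hi
  have := congrArg (fun x => Λ.inner x (v i)) hg
  simp only [inner_sum_left, inner_smul_left, inner_zero_left] at this
  rw [Finset.sum_eq_single i] at this
  · rw [h8] at this; omega
  · intro j _ hj; rw [ho j i hj, mul_zero]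
  · intro h; exact absurd hi h

theorem fiber_card_le (hΛ : IsLeech Λ) (c : Fin 24 → ZMod 2) : (fiber Λ c).ncard ≤ 48 := by
  rw [half_ncard _ (fiber_finite Λ c) (fiber_neg Λ c) (fiber_zero Λ c)]
  have hfh : (half (fiber Λ c)).Finite := (fiber_finite Λ c).subset fun x hx => hx.1
  have : Fintype (half (fiber Λ c)) := hfh.fintype
  have hli := orth_linind Λ (fun x : half (fiber Λ c) => x.1) (fun x => x.2.1.1)
    (fun x y hxy => half_orth Λ hΛ c x.2 y.2 (fun h => hxy (Subtype.ext h)))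
  have h := hli.fintype_card_le_finrank
  rw [← Nat.card_eq_fintype_card, Nat.card_coe_set_eq] at h
  simp at h
  omega

/-- vectors of norm `2n` as a finset -/
noncomputable def shell (n : ℕ) : Finset (Fin 24 → ℤ) :=
  ((finite_le Λ (2 * n)).subset
    (fun _ hx => le_of_eq hx : {x | Λ.inner x x = 2 * (n:ℤ)} ⊆ {x | Λ.inner x x ≤ 2 * n})).toFinset

theorem mem_shell (n : ℕ) (x) : x ∈ shell Λ n ↔ Λ.inner x x = 2 * (n : ℤ) := by
  simp [shell]

theorem shell_card (n : ℕ) : (shell Λ n).card = cnt Λ n := by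
  rw [cnt, ← Set.ncard_coe_finset, ← Nat.card_coe_set_eq]
  exact Nat.card_congr (Equiv.subtypeEquivRight fun x => by
    rw [← mem_shell]; exact Finset.mem_coe)

open Classical in
theorem shell_image (hΛ : IsLeech Λ) (n : ℕ) (hn : n < 4) :
    (shell Λ n).card ≤ 2 * ((shell Λ n).image Λ.red).card := by
  refine Finset.card_le_mul_card_image _ _ fun c hc => ?_
  obtain ⟨v, hv, rfl⟩ := Finset.mem_image.mp hc
  refine (Finset.card_le_card (t := {v, -v}) ?_).trans Finset.card_le_two
  intro u hu
  rw [Finset.mem_filter, mem_shell] at hu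
  rw [mem_shell] at hv
  simp only [Finset.mem_insert, Finset.mem_singleton]
  by_contra hcon
  push Not at hcon
  have := congr_short Λ hΛ (by omega) (by omega) hu.2 hcon.1 hcon.2
  omega

open Classical in
theorem fiber_eq_filter (c : Fin 24 → ZMod 2) :
    (fiber Λ c).ncard = ((shell Λ 4).filter (fun x => Λ.red x = c)).card := by
  rw [← Set.ncard_coe_finset]
  congr 1
  ext x
  simp [fiber, mem_shell]

open Classical in
theorem classes_count (hΛ : IsLeech Λ) : ((shell Λ 4).image Λ.red).card = 8292375 ∧
    ∀ c ∈ (shell Λ 4).image Λ.red, (fiber Λ c).ncard = 48 := by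
  obtain ⟨c2, c3, c4⟩ := cnt_values Λ hΛ
  have h2 := shell_image Λ hΛ 2 (by norm_num)
  have h3 := shell_image Λ hΛ 3 (by norm_num)
  have h4 : (shell Λ 4).card ≤ 48 * ((shell Λ 4).image Λ.red).card := by
    refine Finset.card_le_mul_card_image _ _ fun c hc => ?_
    rw [← fiber_eq_filter]
    exact fiber_card_le Λ hΛ c
  rw [shell_card] at h2 h3 h4
  rw [c2] at h2
  rw [c3] at h3
  rw [c4] at h4
  have hdis : ∀ m n : ℕ, m ≤ 4 → n ≤ 4 → m ≠ n →
      Disjoint ((shell Λ m).image Λ.red) ((shell Λ n).image Λ.red) := by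
    intro m n hm hn hmn
    rw [Finset.disjoint_left]
    intro c hc hc'
    obtain ⟨u, hu, rfl⟩ := Finset.mem_image.mp hc
    obtain ⟨v, hv, huv⟩ := Finset.mem_image.mp hc'
    rw [mem_shell] at hu hv
    by_cases e1 : u = v
    · subst e1; omega
    by_cases e2 : u = -v
    · subst e2
      simp only [inner_neg_left, inner_neg_right, neg_neg] at hu
      omega
    have := congr_short Λ hΛ (by omega) (by omega) huv.symm e1 e2
    omega
  have h0 : ((shell Λ 0).image Λ.red).card ≥ 1 := by
    rw [ge_iff_le, Nat.one_le_iff_ne_zero, ← Nat.pos_iff_ne_zero, Finset.card_pos]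
    exact ⟨Λ.red 0, Finset.mem_image_of_mem _ (by rw [mem_shell]; simp [inner_zero_left])⟩
  have htot : (((shell Λ 0).image Λ.red) ∪ ((shell Λ 2).image Λ.red) ∪ ((shell Λ 3).image Λ.red) ∪
      ((shell Λ 4).image Λ.red)).card ≤ 16777216 := by
    refine (Finset.card_le_univ _).trans ?_
    simp
  rw [Finset.card_union_of_disjoint, Finset.card_union_of_disjoint,
    Finset.card_union_of_disjoint] at htot
  rotate_left
  · exact hdis _ _ (by norm_num) (by norm_num) (by norm_num)
  · rw [Finset.disjoint_union_left]
    exact ⟨hdis _ _ (by norm_num) (by norm_num) (by norm_num),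
      hdis _ _ (by norm_num) (by norm_num) (by norm_num)⟩
  · rw [Finset.disjoint_union_left, Finset.disjoint_union_left]
    exact ⟨⟨hdis _ _ (by norm_num) (by norm_num) (by norm_num),
      hdis _ _ (by norm_num) (by norm_num) (by norm_num)⟩,
      hdis _ _ (by norm_num) (by norm_num) (by norm_num)⟩
  have hcard : ((shell Λ 4).image Λ.red).card = 8292375 := by omega
  refine ⟨hcard, ?_⟩
  have hsum := Finset.card_eq_sum_card_image Λ.red (shell Λ 4)
  rw [shell_card, c4] at hsum
  simp_rw [← fiber_eq_filter] at hsum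
  have hle : ∀ c ∈ (shell Λ 4).image Λ.red, (fiber Λ c).ncard ≤ 48 :=
    fun c _ => fiber_card_le Λ hΛ c
  have heq : ∑ c ∈ (shell Λ 4).image Λ.red, (fiber Λ c).ncard =
      ∑ c ∈ (shell Λ 4).image Λ.red, 48 := by
    rw [← hsum, Finset.sum_const, hcard, smul_eq_mul]
  exact (Finset.sum_eq_sum_iff_of_le hle).mp heq

theorem frame_eq_fiber (hΛ : IsLeech Λ) {S : Set (Fin 24 → ℤ)} (hS : IsFrame Λ S) :
    ∃ x ∈ S, S = fiber Λ (Λ.red x) := by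
  obtain ⟨h48, hneg, h8, hred⟩ := hS
  have hne : S.Nonempty := by
    rw [Set.nonempty_iff_ne_empty]
    rintro rfl
    simp at h48
  obtain ⟨x, hx⟩ := hne
  refine ⟨x, hx, ?_⟩
  refine Set.eq_of_subset_of_ncard_le (fun y hy => ⟨h8 y hy, hred y hy x hx⟩) ?_ (fiber_finite Λ _)
  rw [← Nat.card_coe_set_eq S, h48]
  exact fiber_card_le Λ hΛ _

open Classical in
theorem frame_count (hΛ : IsLeech Λ) :
    Nat.card {S : Set (Fin 24 → ℤ) // IsFrame Λ S} = 8292375 := by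
  obtain ⟨h1, h2⟩ := classes_count Λ hΛ
  rw [← h1, ← Fintype.card_coe, ← Nat.card_eq_fintype_card]
  symm
  refine Nat.card_congr (Equiv.ofBijective (fun c => ⟨fiber Λ c.1, ?_⟩) ⟨?_, ?_⟩)
  · exact ⟨by rw [Nat.card_coe_set_eq, h2 c.1 c.2], fiber_neg Λ c.1, fun v hv => hv.1,
      fun v hv u hu => hv.2.trans hu.2.symm⟩
  · rintro ⟨c, hc⟩ ⟨d, hd⟩ h
    replace h : fiber Λ c = fiber Λ d := congrArg Subtype.val h
    simp only [Subtype.mk.injEq]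
    obtain ⟨x, hx, rfl⟩ := Finset.mem_image.mp hc
    have : x ∈ fiber Λ (Λ.red x) := ⟨by rw [mem_shell] at hx; simpa using hx, rfl⟩
    rw [h] at this
    exact this.2
  · rintro ⟨S, hS⟩
    obtain ⟨x, hx, h⟩ := frame_eq_fiber Λ hΛ hS
    refine ⟨⟨Λ.red x, Finset.mem_image_of_mem _ ?_⟩, Subtype.ext h.symm⟩
    rw [mem_shell, hS.2.2.1 x hx]
    norm_num

/-- Every frame comes from 24 pairwise orthogonal vectors of norm 8. -/
theorem frame_vectors (hΛ : IsLeech Λ) {S : Set (Fin 24 → ℤ)} (hS : IsFrame Λ S) :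
    ∃ v : Fin 24 → Fin 24 → ℤ, (∀ i, Λ.inner (v i) (v i) = 8) ∧
      (∀ i j, i ≠ j → Λ.inner (v i) (v j) = 0) ∧ (∀ i j, Λ.red (v i) = Λ.red (v j)) ∧
      S = {x | ∃ i, x = v i ∨ x = -v i} := by
  obtain ⟨x, hx, h⟩ := frame_eq_fiber Λ hΛ hS
  have hcard : S.ncard = 48 := by rw [← Nat.card_coe_set_eq]; exact hS.1
  rw [h] at hcard
  rw [half_ncard _ (fiber_finite Λ _) (fiber_neg Λ _) (fiber_zero Λ _)] at hcard
  set H := half (fiber Λ (Λ.red x)) with hH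
  have h24 : Nat.card H = 24 := by rw [Nat.card_coe_set_eq]; omega
  have : Finite H := Nat.finite_of_card_ne_zero (by omega)
  let e : Fin 24 ≃ H := (Finite.equivFinOfCardEq h24).symm
  refine ⟨fun i => (e i).1, fun i => (e i).2.1.1, fun i j hij => ?_, fun i j => ?_, ?_⟩
  · exact half_orth Λ hΛ _ (e i).2 (e j).2 (fun h => hij (e.injective (Subtype.ext h)))
  · exact (e i).2.1.2.trans (e j).2.1.2.symm
  · rw [h, half_union _ (fiber_neg Λ _) (fiber_zero Λ _)]
    ext y
    constructor
    · rintro (hy | ⟨z, hz, rfl⟩)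
      · exact ⟨e.symm ⟨y, hy⟩, Or.inl (by simp)⟩
      · exact ⟨e.symm ⟨z, hz⟩, Or.inr (by simp)⟩
    · rintro ⟨i, rfl | rfl⟩
      · exact Or.inl (e i).2
      · exact Or.inr ⟨_, (e i).2, rfl⟩

end LeechAux

namespace LeechAux

/-- Lattices in frame coordinates (scaled by a factor). -/
structure Std (L : AddSubgroup (Fin 24 → ℤ)) : Prop where
  even : ∀ y ∈ L, 16 ∣ y ⬝ᵥ y
  noroot : ∀ y ∈ L, y ⬝ᵥ y ≠ 16
  dual : ∀ z, (∀ y ∈ L, 8 ∣ z ⬝ᵥ y) → z ∈ L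
  D : ∀ i j, (Pi.single i 4 + Pi.single j 4 : Fin 24 → ℤ) ∈ L

/-- Reduction mod 2. -/
def md (y : Fin 24 → ℤ) : Fin 24 → ZMod 2 := fun i => (y i : ZMod 2)

theorem md_add (x y : Fin 24 → ℤ) : md (x + y) = md x + md y := by ext i; simp [md]
theorem md_sub (x y : Fin 24 → ℤ) : md (x - y) = md x - md y := by ext i; simp [md]
theorem md_neg (x : Fin 24 → ℤ) : md (-x) = -md x := by ext i; simp [md]
theorem md_zero : md 0 = 0 := by ext i; simp [md]
theorem md_eq_iff (x y : Fin 24 → ℤ) : md x = md y ↔ ∃ w, x = y + (2:ℤ) • w := by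
  constructor
  · intro h
    have : ∀ i, ∃ c, x i = y i + 2 * c := by
      intro i
      have hi := congrFun h i
      simp only [md] at hi
      have h2 := (ZMod.intCast_eq_intCast_iff_dvd_sub _ _ _).mp hi.symm
      obtain ⟨c, hc⟩ := h2
      exact ⟨c, by push_cast at hc; linarith⟩
    choose c hc using this
    exact ⟨c, funext fun i => by simp [hc]⟩
  · rintro ⟨w, rfl⟩
    funext i
    have : (2 : ZMod 2) = 0 := rfl
    simp [md, this]

theorem exists_lift (c : Fin 24 → ZMod 2) : ∃ y : Fin 24 → ℤ, md y = c ∧ ∀ i, y i = 0 ∨ y i = 1 := by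
  refine ⟨fun i => ((c i).val : ℤ), ?_, ?_⟩
  · ext i; simp [md]
  · intro i
    have := ZMod.val_lt (c i)
    show ((c i).val : ℤ) = 0 ∨ ((c i).val : ℤ) = 1
    omega

/-- The associated binary code. -/
def code (L : AddSubgroup (Fin 24 → ℤ)) : AddSubgroup (Fin 24 → ZMod 2) where
  carrier := {c | ∃ y : Fin 24 → ℤ, (2:ℤ) • y ∈ L ∧ md y = c}
  zero_mem' := ⟨0, by rw [smul_zero]; exact L.zero_mem, md_zero⟩
  add_mem' := by
    rintro a b ⟨x, hx, rfl⟩ ⟨y, hy, rfl⟩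
    exact ⟨x + y, by rw [smul_add]; exact L.add_mem hx hy, md_add _ _⟩
  neg_mem' := by
    rintro a ⟨x, hx, rfl⟩
    exact ⟨-x, by rw [smul_neg]; exact L.neg_mem hx, md_neg _⟩

theorem mem_code {L : AddSubgroup (Fin 24 → ℤ)} {c : Fin 24 → ZMod 2} :
    c ∈ code L ↔ ∃ y : Fin 24 → ℤ, (2:ℤ) • y ∈ L ∧ md y = c := Iff.rfl

/-- Self-dual doubly even codes without words of weight 4. -/
structure IsGolay (C : AddSubgroup (Fin 24 → ZMod 2)) : Prop where
  dual : ∀ d, (∀ c ∈ C, c ⬝ᵥ d = 0) → d ∈ C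
  four : ∀ c ∈ C, 4 ∣ hammingNorm c
  min : ∀ c ∈ C, hammingNorm c ≠ 4

variable {L : AddSubgroup (Fin 24 → ℤ)}

theorem Std.dot (h : Std L) {x y : Fin 24 → ℤ} (hx : x ∈ L) (hy : y ∈ L) : 8 ∣ x ⬝ᵥ y := by
  have h1 := h.even _ (L.add_mem hx hy)
  have h2 := h.even _ hx
  have h3 := h.even _ hy
  rw [add_dotProduct, dotProduct_add, dotProduct_add, dotProduct_comm y x] at h1
  omega

theorem Std.D24 (h : Std L) (z : Fin 24 → ℤ) (hz : 2 ∣ ∑ i, z i) : (4:ℤ) • z ∈ L := by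
  obtain ⟨k, hk⟩ := hz
  have h1 : (4:ℤ) • z = ∑ i, z i • (Pi.single i 4 + Pi.single 0 4 : Fin 24 → ℤ) -
      k • (Pi.single 0 4 + Pi.single 0 4 : Fin 24 → ℤ) := by
    ext j
    simp only [Pi.smul_apply, Pi.sub_apply, Finset.sum_apply, Pi.add_apply, smul_eq_mul, mul_add,
      Finset.sum_add_distrib, ← Finset.sum_mul, hk]
    rw [Finset.sum_eq_single j]
    · simp; ring
    · intro b _ hb; simp [hb.symm]
    · simp
  rw [h1]
  exact L.sub_mem (L.sum_mem fun i _ => L.zsmul_mem (h.D i 0) _) (L.zsmul_mem (h.D 0 0) _)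

theorem Std.parity (h : Std L) {y : Fin 24 → ℤ} (hy : y ∈ L) (i j : Fin 24) : 2 ∣ y i + y j := by
  have := h.dot (h.D i j) hy
  rw [add_dotProduct, single_dotProduct, single_dotProduct] at this
  omega

theorem Std.exists_odd (h : Std L) : ∃ y ∈ L, ∀ i, ¬ 2 ∣ y i := by
  by_contra hcon
  push Not at hcon
  apply h.noroot (Pi.single 0 4)
  · apply h.dual
    intro y hy
    rw [single_dotProduct]
    obtain ⟨i, hi⟩ := hcon y hy
    have := h.parity hy 0 i
    omega
  · rw [single_dotProduct]; simp

theorem sq_mod (y : Fin 24 → ℤ) : ∃ k, y ⬝ᵥ y = hammingNorm (md y) + 4 * k := by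
  have h1 : ∀ i, ∃ k, y i * y i = (if md y i ≠ 0 then 1 else 0) + 4 * k := by
    intro i
    by_cases h : md y i = 0
    · rw [if_neg (not_not.mpr h)]
      obtain ⟨k, hk⟩ := (ZMod.intCast_zmod_eq_zero_iff_dvd (y i) 2).mp h
      exact ⟨k * k, by rw [hk]; push_cast; ring⟩
    · rw [if_pos h]
      have h2 : ¬ (2:ℤ) ∣ y i := fun h2 => h ((ZMod.intCast_zmod_eq_zero_iff_dvd (y i) 2).mpr h2)
      obtain ⟨k, hk⟩ : ∃ k, y i = 2 * k + 1 := ⟨y i / 2, by omega⟩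
      exact ⟨k * k + k, by rw [hk]; ring⟩
  choose k hk using h1
  refine ⟨∑ i, k i, ?_⟩
  rw [dotProduct, Finset.sum_congr rfl fun i _ => hk i, Finset.sum_add_distrib, ← Finset.mul_sum]
  congr 1
  rw [hammingNorm, Finset.sum_boole]

theorem dot_cast (x y : Fin 24 → ℤ) : ((x ⬝ᵥ y : ℤ) : ZMod 2) = md x ⬝ᵥ md y := by
  simp [dotProduct, md]

theorem Std.isGolay (h : Std L) : IsGolay (code L) := by
  refine ⟨?_, ?_, ?_⟩
  · intro d hd
    obtain ⟨o, ho, hodd⟩ := h.exists_odd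
    have hone : (fun _ => 1 : Fin 24 → ZMod 2) ∈ code L := by
      refine ⟨o, L.zsmul_mem ho 2, ?_⟩
      ext i
      rw [md, ZMod.intCast_eq_one_iff_odd, ← Int.not_even_iff_odd, even_iff_two_dvd]
      exact hodd i
    obtain ⟨y, rfl, hy⟩ := exists_lift d
    have hev : ∀ x, (2:ℤ) • x ∈ L → 8 ∣ ((2:ℤ) • y) ⬝ᵥ ((2:ℤ) • x) := by
      intro x hx
      have h1 := hd _ (mem_code.mpr ⟨x, hx, rfl⟩)
      rw [← dot_cast, ZMod.intCast_zmod_eq_zero_iff_dvd, dotProduct_comm] at h1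
      rw [smul_dotProduct, dotProduct_smul]
      simp only [smul_eq_mul]
      push_cast at h1
      omega
    have h1 : (2:ℤ) ∣ y ⬝ᵥ o := by
      have h2 := hd _ (mem_code.mpr ⟨o, L.zsmul_mem ho 2, rfl⟩)
      rw [← dot_cast, ZMod.intCast_zmod_eq_zero_iff_dvd, dotProduct_comm] at h2
      exact h2
    -- the correction
    have key : ∀ w : Fin 24 → ℤ, 8 ∣ ((2:ℤ) • (y + (2:ℤ) • w)) ⬝ᵥ o →
        (2:ℤ) • (y + (2:ℤ) • w) ∈ L := by
      intro w hw
      apply h.dual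
      intro x hx
      have hev2 : ∀ x, (2:ℤ) • x ∈ L → 8 ∣ ((2:ℤ) • (y + (2:ℤ) • w)) ⬝ᵥ ((2:ℤ) • x) := by
        intro x hx
        have := hev x hx
        rw [smul_add, add_dotProduct]
        refine dvd_add this ?_
        rw [smul_smul, smul_dotProduct, dotProduct_smul]
        simp only [smul_eq_mul]
        omega
      by_cases hx2 : 2 ∣ x 0
      · obtain ⟨x', hx'⟩ : ∃ x', x = (2:ℤ) • x' := by
          have : ∀ i, ∃ c, x i = 2 * c := fun i => by
            have := h.parity hx i 0
            exact ⟨x i / 2, by omega⟩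
          choose c hc using this
          exact ⟨c, by ext i; simp [hc]⟩
        rw [hx'] at hx ⊢
        exact hev2 _ hx
      · obtain ⟨x', hx'⟩ : ∃ x', x - o = (2:ℤ) • x' := by
          have : ∀ i, ∃ c, x i - o i = 2 * c := fun i => by
            have h3 := h.parity hx i 0
            have h4 := hodd i
            exact ⟨(x i - o i) / 2, by omega⟩
          choose c hc using this
          exact ⟨c, by ext i; simp [hc]⟩
        have h5 := L.sub_mem hx ho
        rw [hx'] at h5
        have h6 := hev2 _ h5
        rw [← hx', dotProduct_sub] at h6
        exact (dvd_sub_left hw).mp h6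
    by_cases h8 : (4:ℤ) ∣ y ⬝ᵥ o
    · refine ⟨y, ?_, rfl⟩
      have := key 0
      rw [smul_zero, add_zero] at this
      apply this
      rw [smul_dotProduct, smul_eq_mul]
      omega
    · refine ⟨y + (2:ℤ) • Pi.single 0 1, ?_, ?_⟩
      · apply key
        rw [smul_dotProduct, add_dotProduct, smul_dotProduct, single_dotProduct]
        simp only [smul_eq_mul]
        have := hodd 0
        omega
      · exact (md_eq_iff _ _).mpr ⟨_, rfl⟩
  · rintro c ⟨y, hy, rfl⟩
    have h1 := h.even _ hy
    rw [smul_dotProduct, dotProduct_smul] at h1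
    obtain ⟨k, hk⟩ := sq_mod y
    simp only [smul_eq_mul] at h1
    omega
  · rintro c ⟨y, hy, rfl⟩ h4
    obtain ⟨b, hb, hb01⟩ := exists_lift (md y)
    obtain ⟨z, hz⟩ := (md_eq_iff _ _).mp hb.symm
    have hbb : b ⬝ᵥ b = 4 := by
      rw [← hb, hammingNorm] at h4
      have h5 : b ⬝ᵥ b = ∑ i, if md b i ≠ 0 then (1:ℤ) else 0 := by
        refine Finset.sum_congr rfl fun i _ => ?_
        rcases hb01 i with h | h <;> simp [md, h]
      rw [h5, Finset.sum_boole, h4]; rfl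
    have hb1 : ∃ a, b a = 1 := by
      by_contra hcon
      push Not at hcon
      have : b ⬝ᵥ b = 0 := Finset.sum_eq_zero fun i _ => by
        have := (hb01 i).resolve_right (hcon i)
        rw [this]; rfl
      omega
    obtain ⟨a, ha⟩ := hb1
    have fin : ∀ w : Fin 24 → ℤ, 2 ∣ ∑ i, (z i - w i) →
        (b + (2:ℤ) • w) ⬝ᵥ (b + (2:ℤ) • w) = 4 → False := by
      intro w hw hn
      have h1 := h.D24 (z - w) hw
      have h2 := L.sub_mem hy h1
      apply h.noroot _ h2
      have h3 : (2:ℤ) • y - (4:ℤ) • (z - w) = (2:ℤ) • (b + (2:ℤ) • w) := by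
        rw [hz]; ext i; simp; ring
      rw [h3, smul_dotProduct, dotProduct_smul, hn]
      rfl
    by_cases hp : 2 ∣ ∑ i, z i
    · exact fin 0 (by simpa using hp) (by simpa using hbb)
    · refine fin (Pi.single a (-1)) ?_ ?_
      · rw [Finset.sum_sub_distrib, Finset.sum_pi_single']
        simp
        omega
      · simp only [add_dotProduct, dotProduct_add, smul_dotProduct, dotProduct_smul,
          single_dotProduct, dotProduct_single, smul_eq_mul, hbb, ha]
        norm_num [ha]

/-- Normalized description of the lattice from its code. -/
theorem Std.mem_iff (h : Std L) {o : Fin 24 → ℤ} (ho : o ∈ L) (ho1 : ∀ i, 4 ∣ o i - 1)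
    (y : Fin 24 → ℤ) :
    y ∈ L ↔ ∃ x, md x ∈ code L ∧ ((y = (2:ℤ) • x ∧ 4 ∣ ∑ i, x i) ∨
      (y = 1 + (2:ℤ) • x ∧ 4 ∣ (∑ i, x i) + 2)) := by
  choose k hk using ho1
  have hok : o = 1 + (4:ℤ) • k := by ext i; have := hk i; simp; linarith
  have hkodd : ¬ 2 ∣ ∑ i, k i := by
    intro h2
    have h3 := L.sub_mem ho (h.D24 k h2)
    have h4 := h.even _ h3
    have h5 : o - (4:ℤ) • k = 1 := by rw [hok]; abel
    rw [h5] at h4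
    simp [dotProduct] at h4
  have hA : ∀ x, (2:ℤ) • x ∈ L → 4 ∣ ∑ i, x i := by
    intro x hx
    have h1 := h.dot ho hx
    rw [hok, dotProduct_smul, add_dotProduct, smul_dotProduct, one_dotProduct] at h1
    simp only [smul_eq_mul] at h1
    omega
  have hB : ∀ x, md x ∈ code L → 4 ∣ ∑ i, x i → (2:ℤ) • x ∈ L := by
    rintro x ⟨y, hy, hyx⟩ hx
    obtain ⟨w, hw⟩ := (md_eq_iff _ _).mp hyx.symm
    have h1 := hA y hy
    have h2 : (2:ℤ) ∣ ∑ i, w i := by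
      rw [hw] at hx
      simp only [Pi.add_apply, Pi.smul_apply, smul_eq_mul, Finset.sum_add_distrib,
        ← Finset.mul_sum] at hx
      omega
    have h3 := L.add_mem hy (h.D24 w h2)
    rw [hw, smul_add, smul_smul]
    exact h3
  have hC : ∀ x, md (x - (2:ℤ) • k) = md x := by
    intro x
    exact (md_eq_iff _ _).mpr ⟨-k, by rw [smul_neg, sub_eq_add_neg]⟩
  constructor
  · intro hy
    by_cases hy2 : 2 ∣ y 0
    · have : ∀ i, ∃ c, y i = 2 * c := fun i => by
        have := h.parity hy i 0
        exact ⟨y i / 2, by omega⟩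
      choose c hc using this
      have hyc : y = (2:ℤ) • c := by ext i; simp [hc]
      rw [hyc] at hy
      exact ⟨c, ⟨c, hy, rfl⟩, Or.inl ⟨hyc, hA c hy⟩⟩
    · have : ∀ i, ∃ c, y i = 1 + 2 * c := fun i => by
        have := h.parity hy i 0
        exact ⟨(y i - 1) / 2, by omega⟩
      choose c hc using this
      have hyc : y = 1 + (2:ℤ) • c := by ext i; simp [hc]
      have h1 := L.sub_mem hy ho
      have h2 : y - o = (2:ℤ) • (c - (2:ℤ) • k) := by
        rw [hyc, hok]; ext i; simp; ring
      rw [h2] at h1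
      refine ⟨c, ⟨_, h1, hC c⟩, Or.inr ⟨hyc, ?_⟩⟩
      have h3 := hA _ h1
      simp only [Pi.sub_apply, Pi.smul_apply, smul_eq_mul, Finset.sum_sub_distrib,
        ← Finset.mul_sum] at h3
      omega
  · rintro ⟨x, hx, ⟨rfl, h1⟩ | ⟨rfl, h1⟩⟩
    · exact hB x hx h1
    · have h2 := hB (x - (2:ℤ) • k) (by rw [hC]; exact hx) (by
        simp only [Pi.sub_apply, Pi.smul_apply, smul_eq_mul, Finset.sum_sub_distrib,
          ← Finset.mul_sum]
        omega)
      have h3 := L.add_mem h2 ho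
      have h4 : (2:ℤ) • (x - (2:ℤ) • k) + o = 1 + (2:ℤ) • x := by
        rw [hok]; ext i; simp; ring
      rwa [h4] at h3

end LeechAux

namespace LeechAux

/-! ### The biplane on 11 points -/

/-- First end of an edge of the complete graph on five vertices. -/
def es : Fin 10 → Fin 5 := ![0, 0, 0, 0, 1, 1, 1, 2, 2, 3]
/-- Second end of an edge. -/
def et : Fin 10 → Fin 5 := ![1, 2, 3, 4, 2, 3, 4, 3, 4, 4]
/-- Incidence of edges and vertices. -/
def inc (e : Fin 10) (i : Fin 5) : Bool := es e == i || et e == i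
/-- The twelve pentagons as bit masks. -/
def cycTab : Fin 12 → ℕ := ![665, 803, 453, 598, 234, 316, 707, 789, 425, 570, 220, 358]
/-- The twelve pentagons. -/
def cyc (k : Fin 12) (e : Fin 10) : Bool := (cycTab k).testBit e.val
/-- Effect of the transposition of the first two vertices on edges. -/
def esw : Fin 10 → Fin 10 := ![0, 4, 5, 6, 1, 2, 3, 7, 8, 9]

set_option synthInstance.maxSize 10000 in
set_option synthInstance.maxHeartbeats 400000 in
theorem mask_aux : ∀ a b c d e f g h i j : Bool,
    a.toNat + b.toNat + c.toNat + d.toNat = 2 → a.toNat + e.toNat + f.toNat + g.toNat = 2 →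
    b.toNat + e.toNat + h.toNat + i.toNat = 2 → c.toNat + f.toNat + h.toNat + j.toNat = 2 →
    d.toNat + g.toNat + i.toNat + j.toNat = 2 →
    ∃ k : Fin 12, cyc k 0 = a ∧ cyc k 1 = b ∧ cyc k 2 = c ∧ cyc k 3 = d ∧ cyc k 4 = e ∧
      cyc k 5 = f ∧ cyc k 6 = g ∧ cyc k 7 = h ∧ cyc k 8 = i ∧ cyc k 9 = j := by
  decide +kernel

theorem mask_class (m : Fin 10 → Bool)
    (h : ∀ i : Fin 5, ∑ e, (inc e i && m e).toNat = 2) : ∃ k, cyc k = m := by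
  have h0 := h 0
  have h1 := h 1
  have h2 := h 2
  have h3 := h 3
  have h4 := h 4
  simp [Fin.sum_univ_succ, inc, es, et] at h0 h1 h2 h3 h4
  obtain ⟨k, hk⟩ := mask_aux (m 0) (m 1) (m 2) (m 3) (m 4) (m 5) (m 6) (m 7) (m 8) (m 9)
    (by simpa [add_assoc] using h0) (by simpa [add_assoc] using h1)
    (by simpa [add_assoc] using h2) (by simpa [add_assoc] using h3)
    (by simpa [add_assoc] using h4)
  refine ⟨k, funext fun e => ?_⟩
  obtain ⟨k0, k1, k2, k3, k4, k5, k6, k7, k8, k9⟩ := hk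
  fin_cases e <;> assumption

theorem cyc_meet : ∀ k l : Fin 12, ∑ e, (cyc k e && cyc l e).toNat = 2 →
    k ≠ l ∧ (k.val < 6 ↔ l.val < 6) := by decide +kernel

theorem cyc_esw : ∀ (k : Fin 6) (e : Fin 10),
    cyc (Fin.natAdd 6 k) (esw e) = cyc (Fin.castAdd 6 k) e := by decide +kernel

theorem inc_esw : ∀ (e : Fin 10) (i : Fin 5), inc (esw e) (Equiv.swap 0 1 i) = inc e i := by
  decide +kernel

theorem esw_inj : Function.Injective esw := by decide +kernel

theorem inc_ne : ∀ e : Fin 10, es e ≠ et e := by decide +kernel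
theorem inc_inj : ∀ e f : Fin 10, (∀ i, inc e i = inc f i) → e = f := by decide +kernel

/-- Standard incidence. -/
def stdJ : Option (Fin 10) → Fin 5 ⊕ Fin 6 → Bool
  | none, .inl _ => true
  | none, .inr _ => false
  | some e, .inl i => inc e i
  | some e, .inr q => cyc (Fin.castAdd 6 q) e

theorem exists_other {α : Type*} [DecidableEq α] {s : Finset α} (hs : s.card = 2) {a : α}
    (ha : a ∈ s) : ∃ b, b ≠ a ∧ s = {a, b} := by
  obtain ⟨x, y, hxy, rfl⟩ := Finset.card_eq_two.mp hs
  rcases Finset.mem_insert.mp ha with rfl | h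
  · exact ⟨y, hxy.symm, rfl⟩
  · rw [Finset.mem_singleton] at h
    subst h
    exact ⟨x, hxy, Finset.pair_comm _ _⟩

theorem exists_enum {α : Type*} [DecidableEq α] {n : ℕ} {s : Finset α} (hs : s.card = n) :
    ∃ x : Fin n → α, Function.Injective x ∧ ∀ a, a ∈ s ↔ ∃ i, x i = a := by
  subst hs
  refine ⟨fun i => (s.equivFin.symm i : α), fun i j h => ?_, fun a => ⟨fun h => ?_, ?_⟩⟩
  · exact s.equivFin.symm.injective (Subtype.ext h)
  · exact ⟨s.equivFin ⟨a, h⟩, by simp⟩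
  · rintro ⟨i, rfl⟩
    exact (s.equivFin.symm i).2

theorem biplane {α : Type*} [DecidableEq α] (B P : Finset α) (I : α → α → Bool)
    (hB : B.card = 11) (hP : P.card = 11)
    (r1 : ∀ b ∈ B, (P.filter fun p => I b p).card = 5)
    (r2 : ∀ b ∈ B, ∀ c ∈ B, b ≠ c → (P.filter fun p => I b p ∧ I c p).card = 2)
    (c2 : ∀ p ∈ P, ∀ q ∈ P, p ≠ q → (B.filter fun b => I b p ∧ I b q).card = 2) :
    ∃ (f : Option (Fin 10) → α) (g : Fin 5 ⊕ Fin 6 → α), Function.Injective f ∧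
      Function.Injective g ∧ (∀ b, f b ∈ B) ∧ (∀ p, g p ∈ P) ∧ ∀ b p, I (f b) (g p) = stdJ b p := by
  obtain ⟨b0, hb0⟩ : B.Nonempty := by rw [← Finset.card_pos]; omega
  obtain ⟨x, xinj, hx⟩ := exists_enum (r1 b0 hb0)
  have hx' : ∀ i, x i ∈ P ∧ I b0 (x i) = true := fun i => by
    have := (hx (x i)).mpr ⟨i, rfl⟩
    simpa using this
  have hx2 : ∀ p ∈ P, I b0 p = true → ∃ i, x i = p := fun p hp h =>
    (hx p).mp (by simp [hp, h])
  have hz0 : (P.filter fun p => ¬ I b0 p).card = 6 := by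
    have := Finset.card_filter_add_card_filter_not (s := P) (fun p => I b0 p = true)
    rw [r1 b0 hb0] at this
    omega
  obtain ⟨z, zinj, hz⟩ := exists_enum hz0
  have hz' : ∀ i, z i ∈ P ∧ I b0 (z i) = false := fun i => by
    have := (hz (z i)).mpr ⟨i, rfl⟩
    simpa using this
  -- blocks through pairs
  have hy : ∀ e, ∃ y, y ≠ b0 ∧ y ∈ B ∧ ∀ i, I y (x i) = inc e i := by
    intro e
    have h1 := c2 (x (es e)) (hx' _).1 (x (et e)) (hx' _).1 (fun h => inc_ne e (xinj h))
    obtain ⟨y, hy0, hy⟩ := exists_other h1 (a := b0) (by simp [hb0, (hx' _).2])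
    have hyB : y ∈ B.filter fun b => I b (x (es e)) ∧ I b (x (et e)) := by rw [hy]; simp
    rw [Finset.mem_filter] at hyB
    refine ⟨y, hy0, hyB.1, fun i => ?_⟩
    have h2 := r2 b0 hb0 y hyB.1 hy0.symm
    have h3 : ({x (es e), x (et e)} : Finset α) ⊆ P.filter fun p => I b0 p ∧ I y p := by
      intro p hp
      rcases Finset.mem_insert.mp hp with rfl | hp
      · simp [hx', hyB.2]
      · rw [Finset.mem_singleton] at hp
        subst hp
        simp [hx', hyB.2]
    have h4 := Finset.eq_of_subset_of_card_le h3 (by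
      rw [h2, Finset.card_pair (fun h => inc_ne e (xinj h))])
    have h5 : I y (x i) = true ↔ x i ∈ P.filter fun p => I b0 p ∧ I y p := by
      simp [hx']
    rw [Bool.eq_iff_iff, h5, ← h4]
    simp only [Finset.mem_insert, Finset.mem_singleton, xinj.eq_iff, inc,
      Bool.or_eq_true, beq_iff_eq]
    exact or_congr eq_comm eq_comm
  choose y y0 yB yx using hy
  have yinj : Function.Injective y := fun e f h => inc_inj e f fun i => by
    rw [← yx, ← yx, h]
  have hyall : B = insert b0 (Finset.univ.image y) := by
    symm
    apply Finset.eq_of_subset_of_card_le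
    · intro b hb
      rcases Finset.mem_insert.mp hb with rfl | hb
      · exact hb0
      · obtain ⟨e, _, rfl⟩ := Finset.mem_image.mp hb
        exact yB e
    · rw [Finset.card_insert_of_notMem, Finset.card_image_of_injective _ yinj, hB]
      · simp
      · intro h
        obtain ⟨e, _, he⟩ := Finset.mem_image.mp h
        exact y0 e he
  -- sums over blocks
  have hsum : ∀ φ : α → Bool, φ b0 = false →
      (B.filter fun b => φ b).card = ∑ e, (φ (y e)).toNat := by
    intro φ hφ
    rw [Finset.card_filter, hyall, Finset.sum_insert, Finset.sum_image fun a _ b _ h => yinj h, hφ]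
    · simp only [Bool.false_eq_true, if_false, zero_add]
      refine Finset.sum_congr rfl fun e _ => ?_
      cases φ (y e) <;> rfl
    · intro h
      obtain ⟨e, _, he⟩ := Finset.mem_image.mp h
      exact y0 e he
  have hk : ∀ q, ∃ k, cyc k = fun e => I (y e) (z q) := by
    intro q
    apply mask_class
    intro i
    have h1 := c2 (x i) (hx' i).1 (z q) (hz' q).1 (fun h => by
      have h1 := (hx' i).2
      rw [h, (hz' q).2] at h1
      exact absurd h1 (by decide))
    have h2 := hsum (fun b => I b (x i) && I b (z q)) (by simp [hz'])
    simp only [Bool.and_eq_true] at h2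
    rw [h1] at h2
    simp only [yx] at h2
    exact h2.symm
  choose k hk using hk
  have hkm : ∀ q r, q ≠ r → k q ≠ k r ∧ ((k q).val < 6 ↔ (k r).val < 6) := by
    intro q r hqr
    apply cyc_meet
    have h1 := c2 (z q) (hz' q).1 (z r) (hz' r).1 (fun h => hqr (zinj h))
    have h2 := hsum (fun b => I b (z q) && I b (z r)) (by simp [hz'])
    simp only [Bool.and_eq_true] at h2
    rw [h1] at h2
    simp only [hk]
    exact h2.symm
  have hlt : ∀ q r, (k q).val < 6 ↔ (k r).val < 6 := fun q r => by
    by_cases h : q = r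
    · rw [h]
    · exact (hkm q r h).2
  have kinj : Function.Injective k := fun q r h => by
    by_contra hqr
    exact (hkm q r hqr).1 h
  -- final assembly
  have fin : ∀ (x' : Fin 5 → α) (y' : Fin 10 → α) (z' : Fin 6 → α), Function.Injective x' →
      Function.Injective y' → Function.Injective z' → (∀ i, ∃ j, x' i = x j) →
      (∀ e, ∃ f, y' e = y f) → (∀ q, ∃ r, z' q = z r) → (∀ e i, I (y' e) (x' i) = inc e i) →
      (∀ e q, I (y' e) (z' q) = cyc (Fin.castAdd 6 q) e) →
      ∃ (f : Option (Fin 10) → α) (g : Fin 5 ⊕ Fin 6 → α), Function.Injective f ∧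
      Function.Injective g ∧ (∀ b, f b ∈ B) ∧ (∀ p, g p ∈ P) ∧
      ∀ b p, I (f b) (g p) = stdJ b p := by
    intro x' y' z' hxi hyi hzi hxr hyr hzr h1 h2
    refine ⟨fun b => b.elim b0 y', Sum.elim x' z', ?_, ?_, ?_, ?_, ?_⟩
    · rintro (_ | e) (_ | f) h
      · rfl
      · obtain ⟨f', hf⟩ := hyr f
        exact absurd (hf.symm.trans h.symm) (y0 _)
      · obtain ⟨f', hf⟩ := hyr e
        exact absurd (hf.symm.trans h) (y0 _)
      · exact congrArg some (hyi h)
    · apply Function.Injective.sumElim hxi hzi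
      intro i q h
      obtain ⟨j, hj⟩ := hxr i
      obtain ⟨r, hr⟩ := hzr q
      rw [hj, hr] at h
      have h3 := (hx' j).2
      rw [h, (hz' r).2] at h3
      exact absurd h3 (by decide)
    · rintro (_ | e)
      · exact hb0
      · obtain ⟨f', hf⟩ := hyr e
        show y' e ∈ B
        rw [hf]; exact yB _
    · rintro (i | q)
      · obtain ⟨j, hj⟩ := hxr i
        show x' i ∈ P
        rw [hj]; exact (hx' j).1
      · obtain ⟨j, hj⟩ := hzr q
        show z' q ∈ P
        rw [hj]; exact (hz' j).1
    · rintro (_ | e) (i | q)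
      · obtain ⟨j, hj⟩ := hxr i
        show I b0 (x' i) = true
        rw [hj]; exact (hx' j).2
      · obtain ⟨j, hj⟩ := hzr q
        show I b0 (z' q) = false
        rw [hj]; exact (hz' j).2
      · exact h1 e i
      · exact h2 e q
  by_cases h6 : (k 0).val < 6
  · have : ∀ q, ∃ r : Fin 6, Fin.castAdd 6 r = k q := fun q =>
      ⟨⟨(k q).val, (hlt q 0).mpr h6⟩, rfl⟩
    choose ρ hρ using this
    have ρinj : Function.Injective ρ := fun q r h => kinj (by rw [← hρ, ← hρ, h])
    let ρe := Equiv.ofBijective ρ (Finite.injective_iff_bijective.mp ρinj)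
    refine fin x y (z ∘ ρe.symm) xinj yinj (zinj.comp ρe.symm.injective) (fun i => ⟨i, rfl⟩)
      (fun i => ⟨i, rfl⟩) (fun i => ⟨_, rfl⟩) yx fun e q => ?_
    have h1 := congrFun (hk (ρe.symm q)) e
    rw [← hρ] at h1
    have h2 : ρ (ρe.symm q) = q := ρe.apply_symm_apply q
    rw [h2] at h1
    exact h1.symm
  · have : ∀ q, ∃ r : Fin 6, Fin.natAdd 6 r = k q := fun q => by
      have h7 : ¬ (k q).val < 6 := fun h => h6 ((hlt q 0).mp h)
      exact ⟨⟨(k q).val - 6, by omega⟩, Fin.ext (by simp; omega)⟩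
    choose ρ hρ using this
    have ρinj : Function.Injective ρ := fun q r h => kinj (by rw [← hρ, ← hρ, h])
    let ρe := Equiv.ofBijective ρ (Finite.injective_iff_bijective.mp ρinj)
    refine fin (x ∘ Equiv.swap 0 1) (y ∘ esw) (z ∘ ρe.symm) (xinj.comp (Equiv.injective _))
      (yinj.comp esw_inj) (zinj.comp ρe.symm.injective) (fun i => ⟨_, rfl⟩)
      (fun i => ⟨_, rfl⟩) (fun i => ⟨_, rfl⟩) (fun e i => ?_) fun e q => ?_
    · rw [← inc_esw, ← yx]; rfl
    · have h1 := congrFun (hk (ρe.symm q)) (esw e)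
      rw [← hρ] at h1
      have h2 : ρ (ρe.symm q) = q := ρe.apply_symm_apply q
      rw [h2, cyc_esw] at h1
      exact h1.symm

end LeechAux

namespace LeechAux

/-- Binary words. -/
abbrev Wd := Fin 24 → ZMod 2

theorem z2 : ∀ a : ZMod 2, a = 0 ∨ a = 1 := by decide

theorem wt_eq (a : Wd) : hammingNorm a = ∑ i, (a i).val := by
  rw [hammingNorm, Finset.card_filter]
  refine Finset.sum_congr rfl fun i _ => ?_
  rcases z2 (a i) with h | h
  · rw [if_neg (not_not.mpr h), h]; rfl
  · rw [if_pos (by rw [h]; decide), h]; rfl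

theorem wt_add (a b : Wd) :
    hammingNorm (a + b) + 2 * hammingNorm (a * b) = hammingNorm a + hammingNorm b := by
  simp only [wt_eq, Finset.mul_sum, ← Finset.sum_add_distrib]
  refine Finset.sum_congr rfl fun i _ => ?_
  simp only [Pi.add_apply, Pi.mul_apply]
  generalize a i = x
  generalize b i = y
  revert x y
  decide

theorem wt_split (a D : Wd) : hammingNorm (a * (1 + D)) + hammingNorm (a * D) = hammingNorm a := by
  simp only [wt_eq, ← Finset.sum_add_distrib]
  refine Finset.sum_congr rfl fun i _ => ?_
  simp only [Pi.add_apply, Pi.mul_apply, Pi.one_apply]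
  generalize a i = x
  generalize D i = y
  revert x y
  decide

theorem count3 (a b D : Wd) : 2 * (Finset.univ.filter fun i => D i = 1 ∧ a i = 0 ∧ b i = 0).card +
    hammingNorm (a * D) + hammingNorm (b * D) + hammingNorm ((a + b) * D) = 2 * hammingNorm D := by
  have h0 : (Finset.univ.filter fun i => D i = 1 ∧ a i = 0 ∧ b i = 0).card =
      ∑ i, (D i * (1 + a i) * (1 + b i)).val := by
    rw [Finset.card_filter]
    refine Finset.sum_congr rfl fun i _ => ?_
    split_ifs with h
    · rw [h.1, h.2.1, h.2.2]; rfl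
    · rw [eq_comm, ZMod.val_eq_zero]
      revert h
      generalize a i = x
      generalize b i = y
      generalize D i = z
      revert x y z
      decide
  simp only [h0, wt_eq, Finset.mul_sum, ← Finset.sum_add_distrib]
  refine Finset.sum_congr rfl fun i _ => ?_
  simp only [Pi.add_apply, Pi.mul_apply]
  generalize a i = x
  generalize b i = y
  generalize D i = z
  revert x y z
  decide

theorem wt_one : hammingNorm (1 : Wd) = 24 := by
  rw [wt_eq]; rfl

theorem wt_le (a : Wd) : hammingNorm a ≤ 24 := by
  have := hammingNorm_le_card_fintype (x := a)
  simpa using this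

theorem self_add (a : Wd) : a + a = 0 := by
  ext i; exact (by decide : ∀ x : ZMod 2, x + x = 0) (a i)

theorem mul_idem (a : Wd) : a * a = a := by
  ext i; exact (by decide : ∀ x : ZMod 2, x * x = x) (a i)

theorem dot_one (a : Wd) : a ⬝ᵥ 1 = (hammingNorm a : ZMod 2) := by
  rw [wt_eq, dotProduct_one]
  push_cast
  refine Finset.sum_congr rfl fun i _ => ?_
  generalize a i = x
  revert x
  decide

variable {C : AddSubgroup Wd}

theorem IsGolay.one (h : IsGolay C) : (1 : Wd) ∈ C := by
  apply h.dual
  intro c hc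
  rw [dot_one, ZMod.natCast_eq_zero_iff]
  exact dvd_trans (by norm_num) (h.four c hc)

theorem wt_mul_of_dot (a b : Wd) : a ⬝ᵥ b = (hammingNorm (a * b) : ZMod 2) := by
  rw [← dot_one, dotProduct_one]; rfl

theorem IsGolay.dot (h : IsGolay C) {a b : Wd} (ha : a ∈ C) (hb : b ∈ C) : a ⬝ᵥ b = 0 := by
  rw [wt_mul_of_dot, ZMod.natCast_eq_zero_iff]
  have h1 := h.four _ ha
  have h2 := h.four _ hb
  have h3 := h.four _ (C.add_mem ha hb)
  have h4 := wt_add a b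
  omega

theorem IsGolay.wts (h : IsGolay C) {a : Wd} (ha : a ∈ C) : hammingNorm a = 0 ∨
    hammingNorm a = 8 ∨ hammingNorm a = 12 ∨ hammingNorm a = 16 ∨ hammingNorm a = 24 := by
  have h1 := h.four _ ha
  have h2 := h.min _ ha
  have h3 := h.min _ (C.add_mem ha h.one)
  have h4 := wt_add a 1
  rw [mul_one, wt_one] at h4
  have := wt_le a
  omega

/-- A word of weight twelve contains only trivial words. -/
theorem IsGolay.sub12 (h : IsGolay C) {D d : Wd} (hD : D ∈ C) (h12 : hammingNorm D = 12)
    (hd : d ∈ C) (hdD : d * D = d) : d = 0 ∨ d = D := by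
  have h1 := wt_add d D
  rw [hdD, h12] at h1
  have h2 := h.wts hd
  have h3 := h.wts (C.add_mem hd hD)
  have h4 : hammingNorm d = 0 ∨ hammingNorm (d + D) = 0 := by omega
  rcases h4 with h4 | h4
  · exact Or.inl (hammingNorm_eq_zero.mp h4)
  · right
    have h5 := hammingNorm_eq_zero.mp h4
    calc d = d + D + D := by rw [add_assoc, self_add, add_zero]
      _ = D := by rw [h5, zero_add]

theorem IsGolay.proj (h : IsGolay C) (T u : Wd)
    (hu : ∀ d ∈ C, d * T = d → d ⬝ᵥ u = 0) : ∃ c ∈ C, c * T = u * T := by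
  by_contra hcon
  push Not at hcon
  let φ : Wd →ₗ[ZMod 2] Wd := LinearMap.mulRight (ZMod 2) T
  have hn : u * T ∉ (AddSubgroup.toZModSubmodule 2 C).map φ := by
    rintro ⟨c, hc, h1⟩
    exact hcon c hc h1
  obtain ⟨f, hf, hk⟩ := Submodule.exists_le_ker_of_notMem hn
  have hrep : ∀ v, f v = v ⬝ᵥ (fun i => f (Pi.single i 1)) := by
    intro v
    conv_lhs => rw [pi_eq_sum_univ' v]
    rw [map_sum]
    simp [dotProduct]
  set a : Wd := fun i => f (Pi.single i 1) with ha
  have hdot : ∀ v, v ⬝ᵥ (a * T) = f (v * T) := by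
    intro v
    rw [hrep]
    refine Finset.sum_congr rfl fun i _ => ?_
    simp only [Pi.mul_apply]; ring
  have hd : a * T ∈ C := by
    apply h.dual
    intro c hc
    rw [hdot]
    exact hk ⟨c, hc, rfl⟩
  apply hf
  rw [← hdot, dotProduct_comm]
  exact hu _ hd (by rw [mul_assoc, mul_idem])

theorem wt_single_add {p q : Fin 24} (hpq : p ≠ q) :
    hammingNorm (Pi.single p 1 + Pi.single q 1 : Wd) = 2 := by
  have h1 : ∀ p : Fin 24, hammingNorm (Pi.single p 1 : Wd) = 1 := fun p => by
    rw [wt_eq, Finset.sum_eq_single p]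
    · rw [Pi.single_eq_same]; rfl
    · intro b _ hb; simp [hb]
    · simp
  have h2 := wt_add (Pi.single p 1) (Pi.single q 1)
  have h3 : (Pi.single p 1 * Pi.single q 1 : Wd) = 0 := by
    ext i
    by_cases hi : i = p
    · subst hi; simp [hpq]
    · simp [hi]
  rw [h1, h1, h3, hammingNorm_zero] at h2
  omega

theorem IsGolay.dodecad (h : IsGolay C) : ∃ D ∈ C, hammingNorm D = 12 := by
  obtain ⟨c, hc, hcT⟩ := h.proj (Pi.single 0 1 + Pi.single 1 1) (Pi.single 0 1) (by
    intro d hd hdT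
    have h1 := wt_split d (Pi.single 0 1 + Pi.single 1 1)
    have h2 := wt_add d (Pi.single 0 1 + Pi.single 1 1)
    rw [hdT, wt_single_add (by decide)] at h2
    have h3 := h.wts hd
    have h4 : hammingNorm d = 0 := by omega
    rw [hammingNorm_eq_zero.mp h4, zero_dotProduct])
  have hc0 : c 0 = 1 := by have := congrFun hcT 0; simpa using this
  have hc1 : c 1 = 0 := by have := congrFun hcT 1; simpa using this
  have hw0 : hammingNorm c ≠ 0 := fun h0 => by
    rw [hammingNorm_eq_zero.mp h0] at hc0
    exact absurd hc0 (by decide)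
  have hadd := wt_add c 1
  rw [mul_one, wt_one] at hadd
  have hw24 : hammingNorm c ≠ 24 := fun h0 => by
    have h1 := hammingNorm_eq_zero.mp (show hammingNorm (c + 1) = 0 by omega)
    have h2 := congrFun h1 1
    rw [Pi.add_apply, hc1] at h2
    exact absurd h2 (by decide)
  have hO : (∃ D ∈ C, hammingNorm D = 12) ∨ ∃ O ∈ C, hammingNorm O = 8 := by
    rcases h.wts hc with h1 | h1 | h1 | h1 | h1
    · exact absurd h1 hw0
    · exact Or.inr ⟨c, hc, h1⟩
    · exact Or.inl ⟨c, hc, h1⟩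
    · exact Or.inr ⟨c + 1, C.add_mem hc h.one, by omega⟩
    · exact absurd h1 hw24
  rcases hO with hO | ⟨O, hO, hO8⟩
  · exact hO
  obtain ⟨p, hp, q, hq, hpq⟩ := Finset.one_lt_card.mp
    (show 1 < (Finset.univ.filter fun i => O i ≠ 0).card by
      have : (Finset.univ.filter fun i => O i ≠ 0).card = 8 := hO8
      omega)
  have hp1 : O p = 1 := (z2 _).resolve_left (Finset.mem_filter.mp hp).2
  have hq1 : O q = 1 := (z2 _).resolve_left (Finset.mem_filter.mp hq).2
  obtain ⟨c, hc, hcO⟩ := h.proj O (Pi.single p 1 + Pi.single q 1) (by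
    intro d hd hdO
    have h1 := wt_add d O
    rw [hdO, hO8] at h1
    have h2 := h.wts hd
    have h3 := h.wts (C.add_mem hd hO)
    have h4 : hammingNorm d = 0 ∨ hammingNorm (d + O) = 0 := by omega
    rcases h4 with h4 | h4
    · rw [hammingNorm_eq_zero.mp h4, zero_dotProduct]
    · have h5 := hammingNorm_eq_zero.mp h4
      have h6 : d = O := by
        calc d = d + O + O := by rw [add_assoc, self_add, add_zero]
          _ = O := by rw [h5, zero_add]
      rw [h6, dotProduct_add, dotProduct_single, dotProduct_single, hp1, hq1]
      decide)
  have h2 : (Pi.single p 1 + Pi.single q 1 : Wd) * O = Pi.single p 1 + Pi.single q 1 := by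
    ext i
    by_cases hi : i = p
    · subst hi; simp [hp1]
    · by_cases hi2 : i = q
      · subst hi2; simp [hq1]
      · simp [hi, hi2]
  have h3 := wt_add c O
  rw [hcO, h2, wt_single_add hpq, hO8] at h3
  have h4 := h.wts hc
  have h5 := h.wts (C.add_mem hc hO)
  by_cases h6 : hammingNorm c = 12
  · exact ⟨c, hc, h6⟩
  · exact ⟨c + O, C.add_mem hc hO, by omega⟩

theorem IsGolay.compl (h : IsGolay C) {D : Wd} (hD : D ∈ C) (h12 : hammingNorm D = 12) :
    1 + D ∈ C ∧ hammingNorm (1 + D) = 12 := by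
  refine ⟨C.add_mem h.one hD, ?_⟩
  have := wt_add 1 D
  rw [one_mul, wt_one, h12] at this
  omega

theorem IsGolay.hexwt (h : IsGolay C) {D c : Wd} (hD : D ∈ C) (h12 : hammingNorm D = 12)
    (hc : c ∈ C) (h2 : hammingNorm (c * (1 + D)) = 2) : hammingNorm (c * D) = 6 := by
  have h3 := wt_split c D
  have h4 := wt_add c D
  have h5 := h.wts hc
  have h6 := h.wts (C.add_mem hc hD)
  have h7 := wt_split D c
  rw [mul_comm D c] at h7
  omega

theorem IsGolay.hexad (h : IsGolay C) {D : Wd} (hD : D ∈ C) (h12 : hammingNorm D = 12)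
    {a p j : Fin 24} (ha : D a = 0) (hp : D p = 1) (hj : D j = 0) :
    ∃ c ∈ C, c * (1 + D) = Pi.single a 1 + Pi.single j 1 ∧ c p = 0 := by
  obtain ⟨hE, hE12⟩ := h.compl hD h12
  obtain ⟨c, hc, h1⟩ := h.proj (1 + D) (Pi.single a 1 + Pi.single j 1) (by
    intro d hd hdE
    rcases h.sub12 hE hE12 hd hdE with rfl | rfl
    · rw [zero_dotProduct]
    · rw [dotProduct_add, dotProduct_single, dotProduct_single]
      simp only [Pi.add_apply, Pi.one_apply, ha, hj]
      decide)
  have h2 : (Pi.single a 1 + Pi.single j 1 : Wd) * (1 + D) = Pi.single a 1 + Pi.single j 1 := by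
    ext i
    by_cases hi : i = a
    · subst hi; simp [ha]
    · by_cases hi2 : i = j
      · subst hi2; simp [hj]
      · simp [hi, hi2]
  rw [h2] at h1
  rcases z2 (c p) with h3 | h3
  · exact ⟨c, hc, h1, h3⟩
  · refine ⟨c + D, C.add_mem hc hD, ?_, ?_⟩
    · rw [add_mul, h1, mul_add, mul_one, mul_idem, self_add, add_zero]
    · rw [Pi.add_apply, h3, hp]; decide

/-- Counting for the incidence structure. -/
theorem IsGolay.rows (h : IsGolay C) {D : Wd} (hD : D ∈ C) (h12 : hammingNorm D = 12)
    {a p : Fin 24} (hp : D p = 1) {c c' : Wd} (hc : c ∈ C) (hc' : c' ∈ C)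
    {j j' : Fin 24} (hja : j ≠ a) (hja' : j' ≠ a)
    (h1 : c * (1 + D) = Pi.single a 1 + Pi.single j 1)
    (h1' : c' * (1 + D) = Pi.single a 1 + Pi.single j' 1) (h0 : c p = 0) (h0' : c' p = 0) :
    ((Finset.univ.filter fun i => D i = 1 ∧ i ≠ p).filter fun i => c i = 0).card = 5 ∧
    (j ≠ j' → ((Finset.univ.filter fun i => D i = 1 ∧ i ≠ p).filter
      fun i => c i = 0 ∧ c' i = 0).card = 2) := by
  have hw := h.hexwt hD h12 hc (by rw [h1]; exact wt_single_add hja.symm)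
  have hw' := h.hexwt hD h12 hc' (by rw [h1']; exact wt_single_add hja'.symm)
  have key : ∀ x y : Wd, x p = 0 → y p = 0 →
      (Finset.univ.filter fun i => D i = 1 ∧ x i = 0 ∧ y i = 0).card =
      ((Finset.univ.filter fun i => D i = 1 ∧ i ≠ p).filter fun i => x i = 0 ∧ y i = 0).card + 1 := by
    intro x y hx hy
    rw [← Finset.card_insert_of_notMem (a := p)]
    · congr 1
      ext i
      simp only [Finset.mem_filter, Finset.mem_univ, true_and, Finset.mem_insert]
      constructor
      · intro hi
        by_cases hip : i = p
        · exact Or.inl hip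
        · exact Or.inr ⟨⟨hi.1, hip⟩, hi.2⟩
      · rintro (rfl | hi)
        · exact ⟨hp, hx, hy⟩
        · exact ⟨hi.1.1, hi.2⟩
    · simp
  constructor
  · have h2 := count3 c c D
    have h3 := key c c h0 h0
    rw [self_add, zero_mul, hammingNorm_zero, hw, h12, h3] at h2
    simp only [and_self] at h2
    omega
  · intro hjj
    have h4 := h.hexwt hD h12 (C.add_mem hc hc') (by
      have : (c + c') * (1 + D) = Pi.single j 1 + Pi.single j' 1 := by
        rw [add_mul, h1, h1']
        calc (Pi.single a 1 + Pi.single j 1 + (Pi.single a 1 + Pi.single j' 1) : Wd)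
            = Pi.single a 1 + Pi.single a 1 + (Pi.single j 1 + Pi.single j' 1) := by abel
          _ = _ := by rw [self_add, zero_add]
      rw [this]; exact wt_single_add hjj)
    have h2 := count3 c c' D
    have h3 := key c c' h0 h0'
    rw [hw, hw', h4, h12, h3] at h2
    omega

/-- Labels for the coordinates. -/
abbrev Lab := Option (Option (Fin 10)) ⊕ Option (Fin 5 ⊕ Fin 6)

/-- Standard generators. -/
def stdW (b : Option (Fin 10)) : Lab → ZMod 2
  | .inl none => 1
  | .inl (some b') => if b' = b then 1 else 0
  | .inr none => 0
  | .inr (some p) => if stdJ b p then 0 else 1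

/-- Standard dodecad. -/
def stdD : Lab → ZMod 2
  | .inl _ => 0
  | .inr _ => 1

theorem IsGolay.coords (h : IsGolay C) : ∃ e : Lab ≃ Fin 24,
    (∀ b, ∃ c ∈ C, c ∘ e = stdW b) ∧ ∃ D ∈ C, hammingNorm D = 12 ∧ D ∘ e = stdD := by
  obtain ⟨D, hD, h12⟩ := h.dodecad
  obtain ⟨hE, hE12⟩ := h.compl hD h12
  have hcard : (Finset.univ.filter fun i => D i ≠ 0).card = 12 := h12
  have hcardE : (Finset.univ.filter fun i => (1 + D) i ≠ 0).card = 12 := hE12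
  obtain ⟨p0, hp0⟩ : (Finset.univ.filter fun i => D i ≠ 0).Nonempty := by
    rw [← Finset.card_pos]; omega
  obtain ⟨a, ha⟩ : (Finset.univ.filter fun i => (1 + D) i ≠ 0).Nonempty := by
    rw [← Finset.card_pos]; omega
  have hE0 : ∀ i, (1 + D) i = 1 ↔ D i = 0 := fun i =>
    (by decide : ∀ x : ZMod 2, 1 + x = 1 ↔ x = 0) (D i)
  have hE1 : ∀ i, (1 + D) i = 0 ↔ D i = 1 := fun i =>
    (by decide : ∀ x : ZMod 2, 1 + x = 0 ↔ x = 1) (D i)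
  have hne : ∀ x : ZMod 2, x ≠ 0 ↔ x = 1 := by decide
  simp only [hne] at hcard hcardE hp0 ha
  have hp : D p0 = 1 := (Finset.mem_filter.mp hp0).2
  have ha1 : (1 + D) a = 1 := (Finset.mem_filter.mp ha).2
  have ha0 : D a = 0 := (hE0 a).mp ha1
  have hEE : 1 + (1 + D) = D := by rw [← add_assoc, self_add, zero_add]
  have hc : ∀ j, ∃ c, D j = 0 → c ∈ C ∧ c * (1 + D) = Pi.single a 1 + Pi.single j 1 ∧ c p0 = 0 := by
    intro j
    by_cases hj : D j = 0
    · obtain ⟨c, h1, h2, h3⟩ := h.hexad hD h12 ha0 hp hj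
      exact ⟨c, fun _ => ⟨h1, h2, h3⟩⟩
    · exact ⟨0, fun h => absurd h hj⟩
  choose c hc using hc
  have hu : ∀ j, ∃ c, D j = 1 → c ∈ C ∧ c * D = Pi.single p0 1 + Pi.single j 1 ∧ c a = 0 := by
    intro j
    by_cases hj : D j = 1
    · obtain ⟨c, h1, h2, h3⟩ := h.hexad hE hE12 ((hE1 p0).mpr hp) ha1 ((hE1 j).mpr hj)
      rw [hEE] at h2
      exact ⟨c, fun _ => ⟨h1, h2, h3⟩⟩
    · exact ⟨0, fun h => absurd h hj⟩
  choose u hu using hu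
  have hcu : ∀ j p, D j = 0 → D p = 1 → c j p = u p j := by
    intro j p hj hpp
    obtain ⟨h1, h2, h3⟩ := hc j hj
    obtain ⟨k1, k2, k3⟩ := hu p hpp
    have h4 := h.dot h1 k1
    have h5 : c j ⬝ᵥ u p = (c j * (1 + D)) ⬝ᵥ u p + c j ⬝ᵥ (u p * D) := by
      simp only [dotProduct, ← Finset.sum_add_distrib]
      refine Finset.sum_congr rfl fun i _ => ?_
      simp only [Pi.mul_apply, Pi.add_apply, Pi.one_apply]
      generalize c j i = x
      generalize u p i = y
      generalize D i = z
      revert x y z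
      decide
    rw [h5, h2, k2, add_dotProduct, dotProduct_add, single_dotProduct, single_dotProduct,
      dotProduct_single, dotProduct_single, h3, k3] at h4
    simp only [mul_zero, zero_add, one_mul, mul_one] at h4
    revert h4
    generalize c j p = x
    generalize u p j = y
    revert x y
    decide
  have e1 : (Finset.univ.filter fun i => D i = 1 ∧ i ≠ p0) =
      (Finset.univ.filter fun i => D i = 1).erase p0 := by
    ext i; simp [and_comm]
  have e2 : (Finset.univ.filter fun i => (1 + D) i = 1 ∧ i ≠ a) =
      (Finset.univ.filter fun i => (1 + D) i = 1).erase a := by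
    ext i; simp [and_comm]
  obtain ⟨f, g, fi, gi, fB, gP, hfg⟩ := biplane
    (Finset.univ.filter fun i => (1 + D) i = 1 ∧ i ≠ a)
    (Finset.univ.filter fun i => D i = 1 ∧ i ≠ p0) (fun j p => decide (c j p = 0))
    (by rw [e2, Finset.card_erase_of_mem ha, hcardE])
    (by rw [e1, Finset.card_erase_of_mem hp0, hcard])
    (by
      intro b hb
      obtain ⟨-, hb, hba⟩ := Finset.mem_filter.mp hb
      obtain ⟨h1, h2, h3⟩ := hc b ((hE0 b).mp hb)
      simp only [decide_eq_true_eq]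
      exact (h.rows hD h12 hp h1 h1 hba hba h2 h2 h3 h3).1)
    (by
      intro b hb b' hb' hbb
      obtain ⟨-, hb, hba⟩ := Finset.mem_filter.mp hb
      obtain ⟨-, hb', hba'⟩ := Finset.mem_filter.mp hb'
      obtain ⟨h1, h2, h3⟩ := hc b ((hE0 b).mp hb)
      obtain ⟨h1', h2', h3'⟩ := hc b' ((hE0 b').mp hb')
      simp only [decide_eq_true_eq]
      exact (h.rows hD h12 hp h1 h1' hba hba' h2 h2' h3 h3').2 hbb)
    (by
      intro b hb b' hb' hbb
      obtain ⟨-, hb, hba⟩ := Finset.mem_filter.mp hb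
      obtain ⟨-, hb', hba'⟩ := Finset.mem_filter.mp hb'
      obtain ⟨h1, h2, h3⟩ := hu b hb
      obtain ⟨h1', h2', h3'⟩ := hu b' hb'
      simp only [decide_eq_true_eq]
      rw [← hEE] at h2 h2'
      refine Eq.trans ?_ ((h.rows hE hE12 ha1 h1 h1' hba hba' h2 h2' h3 h3').2 hbb)
      congr 1
      refine Finset.filter_congr fun i hi => ?_
      have hi0 := (hE0 i).mp (Finset.mem_filter.mp hi).2.1
      rw [hcu i b hi0 hb, hcu i b' hi0 hb'])
  have hf : ∀ b, D (f b) = 0 ∧ f b ≠ a := fun b => by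
    obtain ⟨-, h1, h2⟩ := Finset.mem_filter.mp (fB b)
    exact ⟨(hE0 _).mp h1, h2⟩
  have hg : ∀ b, D (g b) = 1 ∧ g b ≠ p0 := fun b => (Finset.mem_filter.mp (gP b)).2
  let e0 : Lab → Fin 24 := Sum.elim (fun o => o.elim a f) (fun o => o.elim p0 g)
  have e0D : D ∘ e0 = stdD := by
    funext x
    rcases x with (_ | b) | (_ | p)
    · exact ha0
    · exact (hf b).1
    · exact hp
    · exact (hg p).1
  have e0inj : Function.Injective e0 := by
    apply Function.Injective.sumElim
    · rintro (_ | x) (_ | y) hxy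
      · rfl
      · exact absurd hxy.symm (hf y).2
      · exact absurd hxy (hf x).2
      · exact congrArg some (fi hxy)
    · rintro (_ | x) (_ | y) hxy
      · rfl
      · exact absurd hxy.symm (hg y).2
      · exact absurd hxy (hg x).2
      · exact congrArg some (gi hxy)
    · intro x y hxy
      have h1 := congrFun e0D (.inl x)
      have h2 := congrFun e0D (.inr y)
      have h3 : e0 (.inl x) = e0 (.inr y) := hxy
      simp only [Function.comp_apply] at h1 h2
      rw [h3, h2] at h1
      exact absurd h1 (one_ne_zero (α := ZMod 2))
  have e0bij : Function.Bijective e0 := by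
    rw [Fintype.bijective_iff_injective_and_card]
    exact ⟨e0inj, by simp⟩
  refine ⟨Equiv.ofBijective e0 e0bij, fun b => ⟨c (f b), (hc _ (hf b).1).1, ?_⟩, D, hD, h12, e0D⟩
  obtain ⟨h1, h2, h3⟩ := hc _ (hf b).1
  funext x
  rcases x with (_ | b') | (_ | p)
  · show c (f b) a = 1
    have := congrFun h2 a
    simpa [ha0, (hf b).2, Pi.single_apply, (hf b).2.symm] using this
  · show c (f b) (f b') = if b' = b then 1 else 0
    have := congrFun h2 (f b')
    simpa [(hf b').1, (hf b').2, Pi.single_apply, fi.eq_iff] using this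
  · exact h3
  · show c (f b) (g p) = if stdJ b p then 0 else 1
    have := hfg b p
    rw [← this]
    rcases z2 (c (f b) (g p)) with h4 | h4 <;> simp [h4]

/-- Code in terms of the labels. -/
theorem IsGolay.eq_closure (h : IsGolay C) (e : Lab ≃ Fin 24)
    (hW : ∀ b, ∃ c ∈ C, c ∘ e = stdW b) (hD : ∃ D ∈ C, hammingNorm D = 12 ∧ D ∘ e = stdD)
    (c : Wd) : c ∈ C ↔ c ∘ e ∈ AddSubgroup.closure (Set.range stdW ∪ {stdD}) := by
  obtain ⟨D, hDC, h12, hDe⟩ := hD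
  choose w hwC hwe using hW
  constructor
  · intro hc
    let s : Wd := ∑ b, if c (e (.inl (some b))) = 1 then w b else 0
    have hs : s ∈ C := C.sum_mem fun b _ => by
      split_ifs
      · exact hwC b
      · exact C.zero_mem
    have hse : s ∘ e ∈ AddSubgroup.closure (Set.range stdW ∪ {stdD}) := by
      have : s ∘ e = ∑ b, if c (e (.inl (some b))) = 1 then stdW b else 0 := by
        funext x
        simp only [s, Function.comp_apply, Finset.sum_apply]
        refine Finset.sum_congr rfl fun b _ => ?_
        split_ifs
        · exact congrFun (hwe b) x
        · rfl
      rw [this]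
      refine AddSubgroup.sum_mem _ fun b _ => ?_
      split_ifs
      · exact AddSubgroup.subset_closure (Or.inl ⟨b, rfl⟩)
      · exact AddSubgroup.zero_mem _
    have hsb : ∀ b, s (e (.inl (some b))) = c (e (.inl (some b))) := by
      intro b
      simp only [s, Finset.sum_apply]
      rw [Finset.sum_eq_single b]
      · have := congrFun (hwe b) (.inl (some b))
        simp only [Function.comp_apply, stdW] at this
        rcases z2 (c (e (.inl (some b)))) with h1 | h1
        · rw [h1, if_neg (by decide)]; rfl
        · rw [h1, if_pos rfl, this]; rfl
      · intro b' _ hb'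
        have := congrFun (hwe b') (.inl (some b))
        simp only [Function.comp_apply, stdW, if_neg hb'.symm] at this
        split_ifs
        · exact this
        · rfl
      · simp
    have hd := C.sub_mem hc hs
    have hdb : ∀ b, (c - s) (e (.inl (some b))) = 0 := fun b => by
      rw [Pi.sub_apply, hsb, sub_self]
    have hd0 : (c - s) (e (.inl none)) = 0 := by
      have h1 := h.dot hd (h.compl hDC h12).1
      rw [dotProduct, ← e.sum_comp, Fintype.sum_sum_type, Fintype.sum_option] at h1
      have h2 : ∀ x, (1 + D) (e (.inl x)) = 1 := fun x => by
        have := congrFun hDe (.inl x)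
        simp only [Function.comp_apply] at this
        rw [Pi.add_apply, this]; rfl
      have h3 : ∀ x, (1 + D) (e (.inr x)) = 0 := fun x => by
        have := congrFun hDe (.inr x)
        simp only [Function.comp_apply] at this
        rw [Pi.add_apply, this]; rfl
      simpa only [h2, h3, hdb, mul_zero, zero_mul, mul_one, Finset.sum_const_zero, add_zero] using h1
    have hdD : (c - s) * D = c - s := by
      funext i
      obtain ⟨x, rfl⟩ := e.surjective i
      have hx := congrFun hDe x
      simp only [Function.comp_apply] at hx
      rw [Pi.mul_apply, hx]
      rcases x with (_ | b) | y
      · rw [hd0, zero_mul]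
      · rw [hdb, zero_mul]
      · exact mul_one _
    have hcs : c ∘ e = (c - s) ∘ e + s ∘ e := by funext x; simp
    rw [hcs]
    refine AddSubgroup.add_mem _ ?_ hse
    rcases h.sub12 hDC h12 hd hdD with h1 | h1
    · rw [h1]; exact AddSubgroup.zero_mem _
    · rw [h1, hDe]; exact AddSubgroup.subset_closure (Or.inr rfl)
  · intro hc
    have key : ∀ x ∈ AddSubgroup.closure (Set.range stdW ∪ {stdD}), x ∘ e.symm ∈ C := by
      intro x hx
      induction hx using AddSubgroup.closure_induction with
      | mem x hx =>
        rcases hx with ⟨b, rfl⟩ | rfl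
        · rw [← hwe]
          convert hwC b
          funext i; simp
        · rw [← hDe]
          convert hDC
          funext i; simp
      | zero => exact C.zero_mem
      | add x y _ _ hx hy => exact C.add_mem hx hy
      | neg x _ hx => exact C.neg_mem hx
    have := key _ hc
    convert this
    funext i; simp

theorem golay_unique {C C' : AddSubgroup Wd} (h : IsGolay C) (h' : IsGolay C') :
    ∃ σ : Equiv.Perm (Fin 24), ∀ c, c ∈ C' ↔ c ∘ σ ∈ C := by
  obtain ⟨e, hW, hD⟩ := h.coords
  obtain ⟨e', hW', hD'⟩ := h'.coords
  refine ⟨e.symm.trans e', fun c => ?_⟩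
  rw [h.eq_closure e hW hD, h'.eq_closure e' hW' hD']
  have : (c ∘ (e.symm.trans e')) ∘ e = c ∘ e' := by funext x; simp
  rw [this]

end LeechAux

namespace LeechAux

variable (Λ : EvenUnimodularLattice 24)

/-- Vectors representing a frame. -/
structure FData (v : Fin 24 → Fin 24 → ℤ) : Prop where
  n8 : ∀ i, Λ.inner (v i) (v i) = 8
  orth : ∀ i j, i ≠ j → Λ.inner (v i) (v j) = 0
  cong : ∀ i j, Λ.red (v i) = Λ.red (v j)

/-- Coordinate matrix with respect to a frame. -/
def cm (v : Fin 24 → Fin 24 → ℤ) : Matrix (Fin 24) (Fin 24) ℤ := Matrix.of v * Λ.gram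

theorem cm_mulVec (v : Fin 24 → Fin 24 → ℤ) (x : Fin 24 → ℤ) (i : Fin 24) :
    (cm Λ v).mulVec x i = Λ.inner (v i) x := by
  rw [cm, ← mulVec_mulVec]; rfl

theorem mul_comm_eight (A B : Matrix (Fin 24) (Fin 24) ℤ) (h : A * B = (8:ℤ) • 1) :
    B * A = (8:ℤ) • 1 := by
  let f : Matrix (Fin 24) (Fin 24) ℤ →+* Matrix (Fin 24) (Fin 24) ℚ :=
    (Int.castRingHom ℚ).mapMatrix
  have hf8 : f ((8:ℤ) • 1) = (8:ℚ) • 1 := by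
    rw [map_zsmul, map_one, ← Int.cast_smul_eq_zsmul ℚ]; norm_num
  have h1 : f A * ((1/8 : ℚ) • f B) = 1 := by
    rw [mul_smul_comm, ← map_mul, h, hf8, smul_smul]; norm_num
  have h2 := mul_eq_one_comm.mp h1
  have h3 : f (B * A) = f ((8:ℤ) • 1) := by
    rw [hf8, map_mul, ← h2, smul_mul_assoc, smul_smul]; norm_num
  ext i j
  have h4 := congrFun (congrFun h3 i) j
  simp only [f, RingHom.mapMatrix_apply, Matrix.map_apply, eq_intCast] at h4
  exact_mod_cast h4

variable {Λ} {v : Fin 24 → Fin 24 → ℤ}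

theorem FData.cm_v (h : FData Λ v) (i : Fin 24) : (cm Λ v).mulVec (v i) = Pi.single i 8 := by
  funext j
  rw [cm_mulVec]
  by_cases hij : j = i
  · subst hij; rw [h.n8, Pi.single_eq_same]
  · rw [h.orth _ _ hij, Pi.single_eq_of_ne hij]

theorem FData.mul1 (h : FData Λ v) : cm Λ v * (Matrix.of v)ᵀ = (8:ℤ) • 1 := by
  ext j i
  have := congrFun (h.cm_v i) j
  have h2 : (cm Λ v * (Matrix.of v)ᵀ) j i = (cm Λ v).mulVec (v i) j := rfl
  rw [h2, this, Matrix.smul_apply, Matrix.one_apply, Pi.single_apply]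
  simp

theorem FData.mul2 (h : FData Λ v) : (Matrix.of v)ᵀ * cm Λ v = (8:ℤ) • 1 :=
  mul_comm_eight _ _ h.mul1

theorem FData.gram (h : FData Λ v) : (cm Λ v)ᵀ * cm Λ v = (8:ℤ) • Λ.gram := by
  conv_lhs => lhs; rw [cm]
  rw [transpose_mul, Λ.symm.eq, Matrix.mul_assoc, h.mul2, mul_smul_comm, Matrix.mul_one]

theorem FData.inner8 (h : FData Λ v) (x y : Fin 24 → ℤ) :
    (cm Λ v).mulVec x ⬝ᵥ (cm Λ v).mulVec y = 8 * Λ.inner x y := by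
  rw [dotProduct_mulVec, vecMul_mulVec, h.gram, ← dotProduct_mulVec, smul_mulVec,
    dotProduct_smul, smul_eq_mul]
  rfl

theorem FData.inj (h : FData Λ v) {x y : Fin 24 → ℤ}
    (hxy : (cm Λ v).mulVec x = (cm Λ v).mulVec y) : x = y := by
  have h1 := congrArg (Matrix.of v)ᵀ.mulVec hxy
  rw [mulVec_mulVec, mulVec_mulVec, h.mul2, smul_mulVec, smul_mulVec, one_mulVec, one_mulVec] at h1
  exact smul_right_injective _ (by norm_num : (8:ℤ) ≠ 0) h1

variable (Λ) in
/-- The lattice in frame coordinates. -/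
def lat (v : Fin 24 → Fin 24 → ℤ) : AddSubgroup (Fin 24 → ℤ) :=
  (cm Λ v).mulVecLin.toAddMonoidHom.range

theorem mem_lat {y : Fin 24 → ℤ} : y ∈ lat Λ v ↔ ∃ x, (cm Λ v).mulVec x = y := Iff.rfl

theorem FData.std (h : FData Λ v) (hΛ : IsLeech Λ) : Std (lat Λ v) := by
  refine ⟨?_, ?_, ?_, ?_⟩
  · rintro y ⟨x, rfl⟩
    have h1 := h.inner8 x x
    have h2 : 2 ∣ Λ.inner x x := Λ.even x
    show 16 ∣ (cm Λ v).mulVec x ⬝ᵥ (cm Λ v).mulVec x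
    omega
  · rintro y ⟨x, rfl⟩ h0
    have h1 := h.inner8 x x
    have h2 : (cm Λ v).mulVec x ⬝ᵥ (cm Λ v).mulVec x = 16 := h0
    exact hΛ x (by omega)
  · intro z hz
    have h1 : ∀ a, ∃ t, ((cm Λ v)ᵀ.mulVec z) a = 8 * t := by
      intro a
      have h2 := hz _ (mem_lat.mpr ⟨Pi.single a 1, rfl⟩)
      rw [dotProduct_mulVec, dotProduct_single, mul_one, ← mulVec_transpose] at h2
      exact h2
    choose t ht using h1
    have ht' : (cm Λ v)ᵀ.mulVec z = (8:ℤ) • t := by funext a; simp [ht]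
    have hu : IsUnit Λ.gram.det := by rw [Λ.unimodular]; exact isUnit_one
    refine mem_lat.mpr ⟨Λ.gram⁻¹.mulVec t, ?_⟩
    have h3 : (Matrix.of v)ᵀ.mulVec z = (8:ℤ) • Λ.gram⁻¹.mulVec t := by
      rw [← mulVec_smul, ← ht', mulVec_mulVec, cm, transpose_mul, Λ.symm.eq, ← Matrix.mul_assoc,
        Matrix.nonsing_inv_mul _ hu, Matrix.one_mul]
    have h4 := congrArg (cm Λ v).mulVec h3
    rw [mulVec_mulVec, h.mul1, smul_mulVec, one_mulVec, mulVec_smul] at h4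
    exact (smul_right_injective _ (by norm_num : (8:ℤ) ≠ 0) h4).symm
  · intro i j
    obtain ⟨w, hw⟩ := (red_eq_iff Λ _ _).mp (h.cong i j)
    refine mem_lat.mpr ⟨v j + w, ?_⟩
    apply smul_right_injective _ (by norm_num : (2:ℤ) ≠ 0)
    show (2:ℤ) • (cm Λ v).mulVec (v j + w) = (2:ℤ) • (Pi.single i 4 + Pi.single j 4)
    have h1 : (2:ℤ) • (v j + w) = v i + v j := by rw [hw]; module
    rw [← mulVec_smul, h1, mulVec_add, h.cm_v, h.cm_v]
    funext k
    simp only [Pi.add_apply, Pi.smul_apply, Pi.single_apply, smul_eq_mul]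
    split_ifs <;> norm_num

/-- Every frame has a normalized basis. -/
theorem exists_normal (hΛ : IsLeech Λ) {S : Set (Fin 24 → ℤ)} (hS : IsFrame Λ S) :
    ∃ v : Fin 24 → Fin 24 → ℤ, FData Λ v ∧ S = {x | ∃ i, x = v i ∨ x = -v i} ∧
      ∃ o ∈ lat Λ v, ∀ i, 4 ∣ o i - 1 := by
  obtain ⟨v, h8, ho, hc, hSv⟩ := frame_vectors Λ hΛ hS
  have hF : FData Λ v := ⟨h8, ho, hc⟩
  obtain ⟨y, ⟨x, hx⟩, hy⟩ := (hF.std hΛ).exists_odd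
  have hx : (cm Λ v).mulVec x = y := hx
  have hε : ∀ i, ∃ e : ℤ, (e = 1 ∨ e = -1) ∧ 4 ∣ e * y i - 1 := by
    intro i
    have := hy i
    by_cases h4 : 4 ∣ y i - 1
    · exact ⟨1, Or.inl rfl, by rwa [one_mul]⟩
    · exact ⟨-1, Or.inr rfl, by omega⟩
  choose e he hey using hε
  refine ⟨fun i => e i • v i, ⟨?_, ?_, ?_⟩, ?_, (cm Λ fun i => e i • v i).mulVec x, ⟨x, rfl⟩, ?_⟩
  · intro i
    rw [inner_smul_left, inner_smul_right, h8]
    rcases he i with h | h <;> rw [h] <;> norm_num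
  · intro i j hij
    rw [inner_smul_left, inner_smul_right, ho i j hij]; ring
  · have h1 : ∀ i, Λ.red (e i • v i) = Λ.red (v i) := by
      intro i
      rcases he i with h | h <;> rw [h]
      · rw [one_smul]
      · rw [neg_one_smul, red_neg]
    intro i j
    rw [h1, h1]; exact hc i j
  · rw [hSv]
    ext z
    refine exists_congr fun i => ?_
    show z = v i ∨ z = -v i ↔ z = e i • v i ∨ z = -(e i • v i)
    rcases he i with h | h <;> rw [h]
    · rw [one_smul]
    · rw [neg_one_smul, neg_neg, or_comm]
  · intro i
    rw [cm_mulVec, inner_smul_left, ← cm_mulVec, hx]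
    exact hey i

theorem md_comp (x : Fin 24 → ℤ) (σ : Equiv.Perm (Fin 24)) : md (x ∘ σ) = md x ∘ σ := rfl

theorem transitive (hΛ : IsLeech Λ) {S S' : Set (Fin 24 → ℤ)} (hS : IsFrame Λ S)
    (hS' : IsFrame Λ S') : ∃ U : Matrix (Fin 24) (Fin 24) ℤ, Uᵀ * Λ.gram * U = Λ.gram ∧
        U.mulVec '' S = S' := by
  obtain ⟨v, hv, hSv, o, ho, ho1⟩ := exists_normal hΛ hS
  obtain ⟨v', hv', hSv', o', ho', ho1'⟩ := exists_normal hΛ hS'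
  obtain ⟨σ, hσ⟩ := golay_unique (hv'.std hΛ).isGolay (hv.std hΛ).isGolay
  -- words of the first lattice are carried to the second
  have hL : ∀ y ∈ lat Λ v, y ∘ σ ∈ lat Λ v' := by
    intro y hy
    rw [(hv.std hΛ).mem_iff ho ho1] at hy
    rw [(hv'.std hΛ).mem_iff ho' ho1']
    obtain ⟨x, hx, h1⟩ := hy
    refine ⟨x ∘ σ, ?_, ?_⟩
    · rw [md_comp]; exact (hσ _).mp hx
    · have h2 : ∑ i, (x ∘ σ) i = ∑ i, x i := Equiv.sum_comp σ x
      rw [h2]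
      rcases h1 with ⟨rfl, h1⟩ | ⟨rfl, h1⟩
      · exact Or.inl ⟨rfl, h1⟩
      · exact Or.inr ⟨rfl, h1⟩
  have hcol : ∀ a, ∃ u, (cm Λ v').mulVec u = (cm Λ v).mulVec (Pi.single a 1) ∘ σ := fun a =>
    mem_lat.mp (hL _ (mem_lat.mpr ⟨_, rfl⟩))
  choose u hu using hcol
  let U : Matrix (Fin 24) (Fin 24) ℤ := Matrix.of fun i a => u a i
  have hU : cm Λ v' * U = (cm Λ v).submatrix σ id := by
    ext i a
    have h1 := congrFun (hu a) i
    rw [mulVec_single_one] at h1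
    exact h1
  have hUx : ∀ x, (cm Λ v').mulVec (U.mulVec x) = (cm Λ v).mulVec x ∘ σ := by
    intro x
    rw [mulVec_mulVec, hU]
    rfl
  have hUv : ∀ i, U.mulVec (v i) = v' (σ.symm i) := by
    intro i
    apply hv'.inj
    rw [hUx, hv.cm_v, hv'.cm_v]
    funext j
    simp only [Function.comp_apply, Pi.single_apply, Equiv.eq_symm_apply]
  refine ⟨U, ?_, ?_⟩
  · have h1 : (8:ℤ) • (Uᵀ * Λ.gram * U) = (8:ℤ) • Λ.gram := by
      rw [← hv.gram]
      calc (8:ℤ) • (Uᵀ * Λ.gram * U) = Uᵀ * ((8:ℤ) • Λ.gram) * U := by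
            rw [Matrix.mul_smul, Matrix.smul_mul]
        _ = (cm Λ v' * U)ᵀ * (cm Λ v' * U) := by
            rw [← hv'.gram, transpose_mul]; simp only [Matrix.mul_assoc]
        _ = (cm Λ v)ᵀ * cm Λ v := by
            rw [hU, transpose_submatrix, submatrix_mul_equiv]; simp
    exact smul_right_injective _ (by norm_num : (8:ℤ) ≠ 0) h1
  · rw [hSv, hSv']
    ext z
    constructor
    · rintro ⟨x, ⟨i, rfl | rfl⟩, rfl⟩
      · exact ⟨σ.symm i, Or.inl (hUv i)⟩
      · exact ⟨σ.symm i, Or.inr (by rw [mulVec_neg, hUv])⟩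
    · rintro ⟨i, rfl | rfl⟩
      · exact ⟨v (σ i), ⟨σ i, Or.inl rfl⟩, by rw [hUv, Equiv.symm_apply_apply]⟩
      · exact ⟨-v (σ i), ⟨σ i, Or.inr rfl⟩, by rw [mulVec_neg, hUv, Equiv.symm_apply_apply]⟩

end LeechAux

/-- `Aut(Λ)` acts transitively on the frames of the Leech lattice
`Λ`; the number of frames is `8292375 = 3⁶·5³·7·13`; hence (by orbit–stabilizer) the
stabilizer of a frame has index `8292375` in `Aut(Λ)`, which is odd. -/
theorem aut_transitive_on_frames (Λ : EvenUnimodularLattice 24) (hΛ : IsLeech Λ) :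
    (∀ S S' : Set (Fin 24 → ℤ), IsFrame Λ S → IsFrame Λ S' →
      ∃ U : Matrix (Fin 24) (Fin 24) ℤ, Uᵀ * Λ.gram * U = Λ.gram ∧
        U.mulVec '' S = S') ∧
    Nat.card {S : Set (Fin 24 → ℤ) // IsFrame Λ S} = 8292375 ∧
    8292375 = 3^6 * 5^3 * 7 * 13 ∧
    Odd (Nat.card {S : Set (Fin 24 → ℤ) // IsFrame Λ S}) := by
  have hc := LeechAux.frame_count Λ hΛ
  refine ⟨fun S S' hS hS' => LeechAux.transitive hΛ hS hS', hc, by norm_num, ?_⟩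
  rw [hc]
  exact ⟨4146187, by norm_num⟩
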